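/- arXiv:1607.01530 — 2 statements merged into one kernel-verified Lean document; each statement's English description precedes it below -/
import Mathlib

section
/- For every ε > 0 there exists P₀ such that for every prime p ≥ P₀ there is a point x ∈ X*(p) whose Γ-orbit C(p) satisfies |X*(p) \ C(p)| ≤ p^ε. -/
/-- One step of the Markoff group action: `b` is obtained from `a` by a coordinate
transposition or by one of the three Vieta involutions. -/
def MarkoffStep (p : ℕ) (a b : ZMod p × ZMod p × ZMod p) : Prop :=
  b = (a.2.1, a.1, a.2.2) ∨
  b = (a.1, a.2.2, a.2.1) ∨
  b = (a.2.2, a.2.1, a.1) ∨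
  b = (3 * a.2.1 * a.2.2 - a.1, a.2.1, a.2.2) ∨
  b = (a.1, 3 * a.1 * a.2.2 - a.2.1, a.2.2) ∨
  b = (a.1, a.2.1, 3 * a.1 * a.2.1 - a.2.2)

/-- The Markoff surface mod `p`. -/
def MarkoffX (p : ℕ) : Set (ZMod p × ZMod p × ZMod p) :=
  {x | x.1 ^ 2 + x.2.1 ^ 2 + x.2.2 ^ 2 = 3 * x.1 * x.2.1 * x.2.2}

/-- The punctured Markoff surface `X*(p)`. -/
def MarkoffXstar (p : ℕ) : Set (ZMod p × ZMod p × ZMod p) :=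
  MarkoffX p \ {(0, 0, 0)}

/-- The `Γ`-orbit of a point: the equivalence class under the equivalence relation
generated by the coordinate permutations and the Vieta involutions. -/
def markoffOrbit (p : ℕ) (x : ZMod p × ZMod p × ZMod p) : Set (ZMod p × ZMod p × ZMod p) :=
  {y | Relation.EqvGen (MarkoffStep p) x y}

namespace MarkoffOrbit

open Polynomial

section Stepanov

variable {L : Type*} [Field L]

/-- The cubic polynomial `X (X - b) (a X - 1)`. -/
noncomputable def cubic (a b : L) : L[X] := X * (X - C b) * (C a * X - 1)

/-- The derivation `X (X - b) (a X - 1) d/dX`. -/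
noncomputable def theta (a b : L) : Module.End L L[X] :=
  (LinearMap.mulLeft L (cubic a b)) ∘ₗ derivative

/-- The product of powers of the three factors of `cubic a b`. -/
noncomputable def unitMonomial (a b : L) (e : ℕ × ℕ × ℕ) : L[X] :=
  X ^ e.1 * (X - C b) ^ e.2.1 * (C a * X - 1) ^ e.2.2

/-- The logarithmic derivative of `unitMonomial a b e` with respect to `theta a b`. -/
noncomputable def logDer (a b : L) (e : ℕ × ℕ × ℕ) : L[X] :=
  (e.1 : L[X]) * ((X - C b) * (C a * X - 1)) + (e.2.1 : L[X]) * (X * (C a * X - 1)) +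
    (e.2.2 : L[X]) * (C a * (X * (X - C b)))

/-- The quotient of the `r`-th `theta a b`-derivative of `unitMonomial a b e` by
`unitMonomial a b e`. -/
noncomputable def derQuot (a b : L) (e : ℕ × ℕ × ℕ) : ℕ → L[X]
  | 0 => 1
  | r + 1 => logDer a b e * derQuot a b e r + theta a b (derQuot a b e r)

lemma theta_apply (a b : L) (f : L[X]) : theta a b f = cubic a b * derivative f := rfl

lemma theta_mul (a b : L) (f g : L[X]) :
    theta a b (f * g) = theta a b f * g + f * theta a b g := by
  simp only [theta_apply, derivative_mul]; ring

lemma theta_pow_succ (a b : L) (r : ℕ) (f : L[X]) :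
    (theta a b ^ (r + 1)) f = theta a b ((theta a b ^ r) f) := by
  rw [pow_succ', Module.End.mul_apply]

lemma mul_derivative_pow (q : L[X]) (n : ℕ) :
    q * derivative (q ^ n) = n * q ^ n * derivative q := by
  cases n with
  | zero => simp
  | succ n => rw [derivative_pow]; simp; ring

lemma theta_unitMonomial (a b : L) (e : ℕ × ℕ × ℕ) :
    theta a b (unitMonomial a b e) = unitMonomial a b e * logDer a b e := by
  obtain ⟨i, j, k⟩ := e
  have h1 := mul_derivative_pow (X : L[X]) i
  have h2 := mul_derivative_pow (X - C b : L[X]) j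
  have h3 := mul_derivative_pow (C a * X - 1 : L[X]) k
  simp only [derivative_X, derivative_sub, derivative_C, derivative_mul, derivative_one] at h1 h2 h3
  simp only [theta_apply, unitMonomial, cubic, logDer, derivative_mul]
  linear_combination ((X - C b) * (C a * X - 1) * (X - C b) ^ j * (C a * X - 1) ^ k) * h1 +
    (X * (C a * X - 1) * X ^ i * (C a * X - 1) ^ k) * h2 +
    (X * (X - C b) * X ^ i * (X - C b) ^ j) * h3

lemma theta_pow_unitMonomial (a b : L) (e : ℕ × ℕ × ℕ) (r : ℕ) :
    (theta a b ^ r) (unitMonomial a b e) = unitMonomial a b e * derQuot a b e r := by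
  induction r with
  | zero => simp [derQuot]
  | succ r ih =>
    rw [theta_pow_succ, ih, theta_mul, theta_unitMonomial, derQuot]; ring

lemma natDegree_cubic_le (a b : L) : (cubic a b).natDegree ≤ 3 := by
  unfold cubic; compute_degree

lemma natDegree_logDer_le (a b : L) (e : ℕ × ℕ × ℕ) : (logDer a b e).natDegree ≤ 2 := by
  unfold logDer; compute_degree

lemma natDegree_derQuot_le (a b : L) (e : ℕ × ℕ × ℕ) (r : ℕ) :
    (derQuot a b e r).natDegree ≤ 2 * r := by
  induction r with
  | zero => simp [derQuot]
  | succ r ih =>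
    rw [derQuot]
    refine natDegree_add_le_of_degree_le ?_ ?_
    · refine natDegree_mul_le.trans ?_
      have := natDegree_logDer_le a b e
      omega
    · rw [theta_apply]
      by_cases h0 : (derQuot a b e r).natDegree = 0
      · rw [eq_C_of_natDegree_eq_zero h0]; simp
      refine natDegree_mul_le.trans ?_
      have h1 := natDegree_cubic_le a b
      have h2 := natDegree_derivative_lt h0
      omega

lemma coeff_theta_of_X_pow_dvd (a b : L) {f : L[X]} {o : ℕ} (h : X ^ o ∣ f) :
    X ^ o ∣ theta a b f ∧ (theta a b f).coeff o = b * o * f.coeff o := by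
  obtain ⟨g, rfl⟩ := h
  have key : theta a b (X ^ o * g) =
      X ^ o * ((X - C b) * (C a * X - 1) * ((o : L[X]) * g + X * derivative g)) := by
    have h1 := mul_derivative_pow (X : L[X]) o
    simp only [derivative_X] at h1
    simp only [theta_apply, cubic, derivative_mul]
    linear_combination ((X - C b) * (C a * X - 1) * g) * h1
  refine ⟨⟨_, key⟩, ?_⟩
  rw [key, coeff_X_pow_mul', coeff_X_pow_mul']
  simp [coeff_zero_eq_eval_zero]
  ring

lemma coeff_theta_pow_of_X_pow_dvd (a b : L) {f : L[X]} {o : ℕ} (h : X ^ o ∣ f) (r : ℕ) :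
    X ^ o ∣ (theta a b ^ r) f ∧ ((theta a b ^ r) f).coeff o = (b * o) ^ r * f.coeff o := by
  induction r with
  | zero => simpa using h
  | succ r ih =>
    rw [theta_pow_succ]
    obtain ⟨h1, h2⟩ := coeff_theta_of_X_pow_dvd a b ih.1
    refine ⟨h1, ?_⟩
    rw [h2, ih.2]; ring

lemma coeff_mul_of_X_pow_dvd {f g : L[X]} {m n : ℕ} (hf : X ^ m ∣ f) (hg : X ^ n ∣ g) :
    (f * g).coeff (m + n) = f.coeff m * g.coeff n := by
  obtain ⟨f, rfl⟩ := hf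
  obtain ⟨g, rfl⟩ := hg
  have : X ^ m * f * (X ^ n * g) = X ^ (m + n) * (f * g) := by ring
  rw [this, coeff_X_pow_mul', coeff_X_pow_mul', coeff_X_pow_mul']
  simp [mul_coeff_zero]

/-- The Wronskian (with respect to `theta a b`) of linearly independent polynomials of degree
less than the characteristic does not vanish. -/
theorem wronskian_ne_zero (p : ℕ) [CharP L p] {a b : L} (hb : b ≠ 0) {N : ℕ}
    (G : Fin N → L[X]) (hG : LinearIndependent L G) (hdeg : ∀ j, (G j).natDegree < p) :
    (Matrix.of fun r j : Fin N => (theta a b ^ (r : ℕ)) (G j)).det ≠ 0 := by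
  classical
  intro hdet
  obtain ⟨q, hq0, hq⟩ := Matrix.exists_vecMul_eq_zero_iff.mpr hdet
  have hq' : ∀ j, ∑ r : Fin N, q r * (theta a b ^ (r : ℕ)) (G j) = 0 := fun j => by
    simpa [Matrix.vecMul, dotProduct] using congrFun hq j
  have hex : ∃ e, ∃ r, (q r).coeff e ≠ 0 := by
    by_contra! h
    exact hq0 (funext fun r => Polynomial.ext fun e => by simpa using h e r)
  let e := Nat.find hex
  obtain ⟨r₀, hr₀⟩ : ∃ r, (q r).coeff e ≠ 0 := Nat.find_spec hex
  have hdiv : ∀ r, X ^ e ∣ q r := fun r => by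
    rw [X_pow_dvd_iff]
    intro d hd
    have := Nat.find_min hex hd
    push Not at this
    exact this r
  let h : L[X] := ∑ r : Fin N, C ((q r).coeff e) * X ^ (r : ℕ)
  have hh0 : h ≠ 0 := by
    intro h0
    apply hr₀
    have := congrArg (fun f => f.coeff (r₀ : ℕ)) h0
    simpa [h, finsetSum_coeff, coeff_X_pow, Fin.val_inj, Finset.sum_ite_eq] using this
  have hhdeg : h.natDegree < N := by
    have hN : 0 < N := Fin.pos r₀
    refine lt_of_le_of_lt (natDegree_sum_le_of_forall_le (n := N - 1) _ _ fun r _ => ?_) (by omega)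
    refine (natDegree_C_mul_X_pow_le _ _).trans ?_
    have := r.2
    omega
  let S : Finset ℕ := (Finset.range p).filter fun o => h.eval (b * o) = 0
  have hScard : S.card < N := by
    refine lt_of_le_of_lt ?_ hhdeg
    refine le_trans ?_ ((Multiset.toFinset_card_le _).trans (card_roots' h))
    refine Finset.card_le_card_of_injOn (fun o : ℕ => b * (o : L)) ?_ ?_
    · intro o ho
      simp only [S, Finset.coe_filter, Set.mem_ofPred_eq] at ho
      simp [hh0, ho.2]
    · intro o ho o' ho' hoo
      simp only [S, Finset.coe_filter, Set.mem_ofPred_eq, Finset.mem_range] at ho ho'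
      have := mul_left_cancel₀ hb hoo
      rw [CharP.natCast_eq_natCast L p] at this
      exact Nat.ModEq.eq_of_lt_of_lt this ho.1 ho'.1
  let T : (Fin N → L) →ₗ[L] (S → L) :=
    LinearMap.pi fun s => (lcoeff L (s : ℕ)) ∘ₗ (Fintype.linearCombination L G)
  have hker : LinearMap.ker T ≠ ⊥ := LinearMap.ker_ne_bot_of_finrank_lt (by simpa using hScard)
  obtain ⟨c, hc, hc0⟩ := (Submodule.ne_bot_iff _).mp hker
  let f : L[X] := Fintype.linearCombination L G c
  have hf : f = ∑ j, c j • G j := Fintype.linearCombination_apply L G c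
  have hf0 : f ≠ 0 := by
    intro h0
    apply hc0
    funext j
    exact Fintype.linearIndependent_iff.mp hG c (hf ▸ h0) j
  have hfS : ∀ s ∈ S, f.coeff s = 0 := fun s hs => congrFun (LinearMap.mem_ker.mp hc) ⟨s, hs⟩
  have hfdeg : f.natDegree < p := by
    have hp : 0 < p := by
      have := hdeg r₀
      omega
    refine lt_of_le_of_lt (b := p - 1) ?_ (by omega)
    rw [hf]
    refine natDegree_sum_le_of_forall_le _ _ fun j _ => ?_
    refine (natDegree_smul_le _ _).trans ?_
    have := hdeg j
    omega
  let o := f.natTrailingDegree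
  have ho : X ^ o ∣ f := by
    rw [X_pow_dvd_iff]
    exact fun d hd => coeff_eq_zero_of_lt_natTrailingDegree hd
  have hsum : ∑ r : Fin N, q r * (theta a b ^ (r : ℕ)) f = 0 := by
    simp only [hf, map_sum, map_smul, Finset.mul_sum]
    rw [Finset.sum_comm]
    refine Finset.sum_eq_zero fun j _ => ?_
    simp only [mul_smul_comm, ← Finset.smul_sum, hq' j, smul_zero]
  have hcoef := congrArg (fun g => g.coeff (e + o)) hsum
  simp only [finsetSum_coeff, coeff_zero] at hcoef
  have hev : h.eval (b * o) * f.coeff o = 0 := by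
    rw [← hcoef]
    simp only [h, eval_finsetSum, Finset.sum_mul]
    refine Finset.sum_congr rfl fun r _ => ?_
    obtain ⟨h1, h2⟩ := coeff_theta_pow_of_X_pow_dvd a b ho r
    rw [coeff_mul_of_X_pow_dvd (hdiv r) h1, h2]
    simp
    ring
  have hfo : f.coeff o ≠ 0 := by
    have := trailingCoeff_nonzero_iff_nonzero.mpr hf0
    exact this
  have hoS : o ∈ S := by
    simp only [S, Finset.mem_filter, Finset.mem_range]
    exact ⟨lt_of_le_of_lt (natTrailingDegree_le_natDegree f) hfdeg,
      (mul_eq_zero.mp hev).resolve_right hfo⟩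
  exact hfo (hfS o hoS)

lemma unitMonomial_ne_zero (a b : L) (e : ℕ × ℕ × ℕ) : unitMonomial a b e ≠ 0 := by
  have h : (C a * X - 1 : L[X]) ≠ 0 := by
    intro h
    simpa using congrArg (eval 0) h
  exact mul_ne_zero (mul_ne_zero (pow_ne_zero _ X_ne_zero) (pow_ne_zero _ (X_sub_C_ne_zero b)))
    (pow_ne_zero _ h)

lemma natDegree_unitMonomial_le (a b : L) (e : ℕ × ℕ × ℕ) :
    (unitMonomial a b e).natDegree ≤ e.1 + e.2.1 + e.2.2 := by
  unfold unitMonomial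
  refine natDegree_mul_le_of_le (natDegree_mul_le_of_le ?_ ?_) ?_
  · simp
  · simp
  · have h : (C a * X - 1 : L[X]).natDegree ≤ 1 := by compute_degree
    simpa using natDegree_pow_le_of_le e.2.2 h

lemma rootMultiplicity_zero_unitMonomial {a b : L} (hb : b ≠ 0) (e : ℕ × ℕ × ℕ) :
    (unitMonomial a b e).rootMultiplicity 0 = e.1 := by
  have h := unitMonomial_ne_zero a b e
  unfold unitMonomial at h ⊢
  rw [rootMultiplicity_mul h, rootMultiplicity_mul (left_ne_zero_of_mul h),
    rootMultiplicity_eq_zero (p := (X - C b) ^ e.2.1),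
    rootMultiplicity_eq_zero (p := (C a * X - 1) ^ e.2.2)]
  · simpa using rootMultiplicity_X_sub_C_pow (0 : L) e.1
  · simp [IsRoot]
  · simp [IsRoot, hb]

lemma rootMultiplicity_unitMonomial {a b : L} (hb : b ≠ 0) (hab : a * b ≠ 1) (e : ℕ × ℕ × ℕ) :
    (unitMonomial a b e).rootMultiplicity b = e.2.1 := by
  have h := unitMonomial_ne_zero a b e
  unfold unitMonomial at h ⊢
  rw [rootMultiplicity_mul h, rootMultiplicity_mul (left_ne_zero_of_mul h),
    rootMultiplicity_eq_zero (p := X ^ e.1), rootMultiplicity_eq_zero (p := (C a * X - 1) ^ e.2.2)]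
  · simpa using rootMultiplicity_X_sub_C_pow b e.2.1
  · simp [IsRoot, sub_eq_zero, hab]
  · simp [IsRoot, hb]

/-- In a linear relation between unit monomials, the exponents differ by at most the square
of the number of terms. -/
lemma exponent_le_of_relation (p : ℕ) [CharP L p] {a b : L} (hb : b ≠ 0) (hab : a * b ≠ 1)
    {N : ℕ} (e : Fin N → ℕ × ℕ × ℕ) (e₀ : ℕ × ℕ × ℕ) (c : Fin N → L) (c₀ : L)
    (hli : LinearIndependent L fun j => unitMonomial a b (e j))
    (hdeg : ∀ j, (e j).1 + (e j).2.1 + (e j).2.2 < p)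
    (hrel : ∑ j, c j • unitMonomial a b (e j) = c₀ • unitMonomial a b e₀)
    (j₁ : Fin N) (hj₁ : c j₁ ≠ 0) :
    e₀.1 ≤ (e j₁).1 + N ^ 2 ∧ e₀.2.1 ≤ (e j₁).2.1 + N ^ 2 := by
  classical
  let M : Matrix (Fin N) (Fin N) L[X] := Matrix.of fun r j => derQuot a b (e j) r
  have hM : M.det ≠ 0 := by
    have h := wronskian_ne_zero (a := a) p hb _ hli
      fun j => (natDegree_unitMonomial_le a b (e j)).trans_lt (hdeg j)
    intro h0
    apply h
    have : (Matrix.of fun r j : Fin N => (theta a b ^ (r : ℕ)) (unitMonomial a b (e j))) =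
        Matrix.of fun r j => unitMonomial a b (e j) * M r j := by
      ext1 r j
      simp [M, theta_pow_unitMonomial]
    rw [this, Matrix.det_mul_row, h0, mul_zero]
  have hMdeg : M.det.natDegree ≤ N ^ 2 := by
    rw [Matrix.det_apply]
    refine natDegree_sum_le_of_forall_le _ _ fun σ _ => ?_
    refine (natDegree_smul_le _ _).trans ?_
    refine (natDegree_prod_le _ _).trans ?_
    have h1 : ∀ i ∈ (Finset.univ : Finset (Fin N)), (M (σ i) i).natDegree ≤ 2 * (σ i : ℕ) :=
      fun i _ => natDegree_derQuot_le a b (e i) (σ i)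
    refine (Finset.sum_le_sum h1).trans ?_
    rw [Equiv.sum_comp σ (fun i : Fin N => 2 * (i : ℕ)), Fin.sum_univ_eq_sum_range (fun i => 2 * i),
      ← Finset.mul_sum, mul_comm, Finset.sum_range_id_mul_two, sq]
    exact Nat.mul_le_mul_left _ (Nat.sub_le _ _)
  let x : Fin N → L[X] := fun j => c j • unitMonomial a b (e j)
  let y : Fin N → L[X] := fun r => (c₀ • unitMonomial a b e₀) * derQuot a b e₀ r
  have hMx : M.mulVec x = y := by
    funext r
    have h := congrArg (theta a b ^ (r : ℕ)) hrel
    simp only [map_sum, map_smul, theta_pow_unitMonomial] at h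
    simp only [Matrix.mulVec, dotProduct, M, x, y, Matrix.of_apply]
    rw [smul_mul_assoc, ← h]
    exact Finset.sum_congr rfl fun j _ => by rw [mul_smul_comm, mul_comm]
  have hdvd : unitMonomial a b e₀ ∣ M.det * unitMonomial a b (e j₁) := by
    have h1 : M.det • x = M.adjugate.mulVec y := by
      rw [← hMx, Matrix.mulVec_mulVec, Matrix.adjugate_mul, Matrix.smul_mulVec, Matrix.one_mulVec]
    have h2 := congrFun h1 j₁
    have h3 : unitMonomial a b e₀ ∣ M.det * x j₁ := by
      rw [show M.det * x j₁ = (M.det • x) j₁ from rfl, h2]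
      simp only [Matrix.mulVec, dotProduct]
      refine Finset.dvd_sum fun r _ => Dvd.dvd.mul_left ?_ _
      simp only [y, smul_eq_C_mul, mul_assoc]
      exact Dvd.dvd.mul_left (Dvd.intro _ rfl) _
    simp only [x, mul_smul_comm] at h3
    rwa [smul_eq_C_mul, IsUnit.dvd_mul_left] at h3
    simpa using hj₁
  have hne : M.det * unitMonomial a b (e j₁) ≠ 0 := mul_ne_zero hM (unitMonomial_ne_zero _ _ _)
  have key : ∀ z : L, (unitMonomial a b e₀).rootMultiplicity z ≤
      (unitMonomial a b (e j₁)).rootMultiplicity z + N ^ 2 := fun z => by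
    have h1 := rootMultiplicity_le_rootMultiplicity_of_dvd hne hdvd z
    rw [rootMultiplicity_mul hne] at h1
    have h2 : M.det.rootMultiplicity z ≤ M.det.natDegree := by
      rw [← count_roots]
      exact (Multiset.count_le_card _ _).trans (card_roots' _)
    omega
  have k0 := key 0
  have kb := key b
  rw [rootMultiplicity_zero_unitMonomial hb, rootMultiplicity_zero_unitMonomial hb] at k0
  rw [rootMultiplicity_unitMonomial hb hab, rootMultiplicity_unitMonomial hb hab] at kb
  exact ⟨k0, kb⟩

/-- A linearly dependent finite family contains a minimal relation: one with nonzero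
coefficients such that removing any of its vectors leaves an independent family. -/
lemma exists_minimal_relation {ι V : Type*} [AddCommGroup V] [Module L V] [Finite ι]
    [DecidableEq ι] (f : ι → V)
    (h : ¬ LinearIndependent L f) :
    ∃ (s : Finset ι) (c : ι → L), s.Nonempty ∧ (∀ i ∈ s, c i ≠ 0) ∧ ∑ i ∈ s, c i • f i = 0 ∧
      ∀ i ∈ s, LinearIndepOn L f (s.erase i : Finset ι) := by
  classical
  have := Fintype.ofFinite ι
  have hex : ∃ n, ∃ s : Finset ι, s.card = n ∧ ¬ LinearIndepOn L f (s : Set ι) :=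
    ⟨_, Finset.univ, rfl, by simpa [linearIndepOn_univ_iff] using h⟩
  obtain ⟨s, hs, hdep⟩ := Nat.find_spec hex
  have hmin : ∀ i ∈ s, LinearIndepOn L f (s.erase i : Finset ι) := by
    intro i hi
    by_contra hcon
    refine Nat.find_min hex ?_ ⟨s.erase i, rfl, hcon⟩
    rw [← hs]
    exact Finset.card_erase_lt_of_mem hi
  rw [linearIndepOn_finset_iff] at hdep
  push Not at hdep
  obtain ⟨c, hc, i₀, hi₀, hci₀⟩ := hdep
  refine ⟨s, c, ⟨i₀, hi₀⟩, ?_, hc, ?_⟩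
  · intro i hi h0
    have h1 := hmin i hi
    rw [linearIndepOn_finset_iff] at h1
    have hne : i₀ ≠ i := fun h => hci₀ (h ▸ h0)
    refine hci₀ (h1 c ?_ i₀ (Finset.mem_erase.mpr ⟨hne, hi₀⟩))
    rw [← hc, ← Finset.add_sum_erase _ _ hi, h0, zero_smul, zero_add]
  · exact hmin

/-- The exponents of the monomials entering the auxiliary polynomial. -/
def auxExp (m n B : ℕ) {A : ℕ} (q : Fin A × Fin B × Fin B) : ℕ × ℕ × ℕ :=
  (q.1 + m * q.2.2 + n * (B - 1 - q.2.1), m * q.2.2 + n * q.2.1,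
    m * (B - 1 - q.2.2) + n * (B - 1 - q.2.1))

lemma auxExp_sum_le (m n B : ℕ) {A : ℕ} (q : Fin A × Fin B × Fin B) :
    (auxExp m n B q).1 + (auxExp m n B q).2.1 + (auxExp m n B q).2.2 ≤ A + 2 * (m + n) * B := by
  obtain ⟨i, k, l⟩ := q
  simp only [auxExp]
  have hi := i.2
  obtain ⟨x, hx⟩ : ∃ x, B = k + 1 + x := ⟨B - 1 - k, by omega⟩
  obtain ⟨y, hy⟩ : ∃ y, B = l + 1 + y := ⟨B - 1 - l, by omega⟩
  have h1 : B - 1 - (k : ℕ) = x := by omega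
  have h2 : B - 1 - (l : ℕ) = y := by omega
  rw [h1, h2]
  have e1 : m * B = m * l + m + m * y :=
    (congrArg (m * ·) hy).trans (by ring)
  have e2 : n * B = n * k + n + n * x :=
    (congrArg (n * ·) hx).trans (by ring)
  have e3 : 2 * (m + n) * B = 2 * (m * B) + 2 * (n * B) := by ring
  rw [e3, e1, e2]
  have := Nat.zero_le (m * y)
  omega

lemma abs_sub_le_of_minimal_relation (p : ℕ) [CharP L p] {a b : L} (hb : b ≠ 0)
    (hab : a * b ≠ 1) {ι : Type*} [Fintype ι] [DecidableEq ι] (e : ι → ℕ × ℕ × ℕ)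
    (hdeg : ∀ j, (e j).1 + (e j).2.1 + (e j).2.2 < p) {s : Finset ι} {c : ι → L}
    (hc : ∀ i ∈ s, c i ≠ 0) (hrel : ∑ i ∈ s, c i • unitMonomial a b (e i) = 0)
    (hs : ∀ i ∈ s, LinearIndepOn L (fun i => unitMonomial a b (e i)) (s.erase i : Finset ι))
    {i₀ i₁ : ι} (h₀ : i₀ ∈ s) (h₁ : i₁ ∈ s) :
    (e i₀).1 ≤ (e i₁).1 + Fintype.card ι ^ 2 ∧ (e i₀).2.1 ≤ (e i₁).2.1 + Fintype.card ι ^ 2 := by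
  rcases eq_or_ne i₁ i₀ with rfl | hne
  · exact ⟨Nat.le_add_right _ _, Nat.le_add_right _ _⟩
  let g := (s.erase i₀).equivFin.symm
  have hli : LinearIndependent L fun j => unitMonomial a b (e (g j)) :=
    LinearIndependent.comp (hs i₀ h₀) g g.injective
  have hrel' : ∑ j, c (g j) • unitMonomial a b (e (g j)) = (-c i₀) • unitMonomial a b (e i₀) := by
    rw [Equiv.sum_comp g (fun x => c x • unitMonomial a b (e x)),
      Finset.sum_coe_sort (s.erase i₀) (fun x => c x • unitMonomial a b (e x)), neg_smul,
      eq_neg_iff_add_eq_zero, Finset.sum_erase_add _ _ h₀, hrel]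
  have hmem : i₁ ∈ s.erase i₀ := Finset.mem_erase.mpr ⟨hne, h₁⟩
  have h := exponent_le_of_relation p hb hab (fun j => e (g j)) (e i₀) (fun j => c (g j)) (-c i₀)
    hli (fun j => hdeg _) hrel' (g.symm ⟨i₁, hmem⟩) (by simpa using hc i₁ h₁)
  simp only [Equiv.apply_symm_apply] at h
  have hcard : (s.erase i₀).card ^ 2 ≤ Fintype.card ι ^ 2 :=
    Nat.pow_le_pow_left (Finset.card_le_univ _) 2
  omega

theorem linearIndependent_aux (p : ℕ) [CharP L p] {a b : L} (hb : b ≠ 0) (hab : a * b ≠ 1)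
    (A B m n : ℕ) (hm : (A * B ^ 2) ^ 2 + A ≤ m) (hn : (A * B ^ 2) ^ 2 + A ≤ n)
    (hdeg : A + 2 * (m + n) * B < p) :
    LinearIndependent L
      fun q : Fin A × Fin B × Fin B => unitMonomial a b (auxExp m n B q) := by
  classical
  by_contra hdep
  obtain ⟨s, c, ⟨q₀, hq₀⟩, hc, hrel, hs⟩ := exists_minimal_relation _ hdep
  have hcard : Fintype.card (Fin A × Fin B × Fin B) = A * B ^ 2 := by simp [sq]
  have hgap : ∀ {q q' : Fin A × Fin B × Fin B}, q ∈ s → q' ∈ s →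
      (auxExp m n B q).1 ≤ (auxExp m n B q').1 + (A * B ^ 2) ^ 2 ∧
      (auxExp m n B q).2.1 ≤ (auxExp m n B q').2.1 + (A * B ^ 2) ^ 2 := fun hq hq' => by
    rw [← hcard]
    exact abs_sub_le_of_minimal_relation p hb hab (auxExp m n B)
      (fun j => (auxExp_sum_le m n B j).trans_lt hdeg) hc hrel hs hq hq'
  have hle : ∀ {q q' : Fin A × Fin B × Fin B}, q ∈ s → q' ∈ s →
      q.2.1 ≤ q'.2.1 ∧ q.2.2 ≤ q'.2.2 := by
    rintro ⟨i, k, l⟩ ⟨i', k', l'⟩ hq hq'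
    obtain ⟨h1, h2⟩ := hgap hq hq'
    obtain ⟨h3, h4⟩ := hgap hq' hq
    simp only [auxExp, ← Fin.val_fin_le] at h1 h2 h3 h4 ⊢
    have hi := i.2
    have hi' := i'.2
    have hk := k.2
    have hk' := k'.2
    obtain ⟨x, hx⟩ : ∃ x, B = k + 1 + x := ⟨B - 1 - k, by omega⟩
    obtain ⟨x', hx'⟩ : ∃ x, B = k' + 1 + x := ⟨B - 1 - k', by omega⟩
    rw [show B - 1 - (k : ℕ) = x by omega, show B - 1 - (k' : ℕ) = x' by omega] at h1 h3
    generalize (A * B ^ 2) ^ 2 = Q at *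
    constructor
    · by_contra! hlt
      have e : n * (k' + 1) ≤ n * k := Nat.mul_le_mul_left _ hlt
      have e' : n * (x + 1) ≤ n * x' := Nat.mul_le_mul_left _ (by omega)
      rw [mul_add, mul_one] at e e'
      omega
    · by_contra! hlt
      have e : m * (l' + 1) ≤ m * l := Nat.mul_le_mul_left _ hlt
      rw [mul_add, mul_one] at e
      have e2 : n * k + n * x = n * k' + n * x' := by
        rw [← mul_add, ← mul_add]; congr 1; omega
      omega
  have hsnd : ∀ q ∈ s, q.2 = q₀.2 := fun q hq =>
    Prod.ext (le_antisymm (hle hq hq₀).1 (hle hq₀ hq).1) (le_antisymm (hle hq hq₀).2 (hle hq₀ hq).2)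
  let e₀ : ℕ × ℕ × ℕ := (m * q₀.2.2 + n * (B - 1 - q₀.2.1), (auxExp m n B q₀).2)
  have hfac : ∀ q ∈ s, c q • unitMonomial a b (auxExp m n B q) =
      (c q • (X : L[X]) ^ (q.1 : ℕ)) * unitMonomial a b e₀ := fun q hq => by
    rw [smul_mul_assoc]
    congr 1
    simp only [unitMonomial, auxExp, e₀, hsnd q hq]
    rw [add_assoc (q.1 : ℕ), pow_add]
    ring
  rw [Finset.sum_congr rfl hfac, ← Finset.sum_mul] at hrel
  have hsum := (mul_eq_zero.mp hrel).resolve_right (unitMonomial_ne_zero _ _ _)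
  have hcoef := congrArg (fun f => f.coeff (q₀.1 : ℕ)) hsum
  simp only [finsetSum_coeff, coeff_smul, coeff_X_pow, coeff_zero, smul_eq_mul, mul_ite, mul_one,
    mul_zero] at hcoef
  rw [Finset.sum_eq_single_of_mem q₀ hq₀, if_pos rfl] at hcoef
  · exact hc q₀ hq₀ hcoef
  · intro q hq hne
    rw [if_neg]
    intro h
    exact hne (Prod.ext (Fin.ext h.symm) (hsnd q hq))

lemma eval_theta_pow_ne_zero (p : ℕ) [CharP L p] {a b u : L} (hu : (cubic a b).eval u ≠ 0)
    (s : ℕ) (hs : s < p) (g : L[X]) (hg : g.eval u ≠ 0) :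
    ((theta a b ^ s) ((X - C u) ^ s * g)).eval u ≠ 0 := by
  induction s generalizing g with
  | zero => simpa using hg
  | succ s ih =>
    have key : theta a b ((X - C u) ^ (s + 1) * g) = (X - C u) ^ s *
        (((s + 1 : ℕ) : L[X]) * cubic a b * g + (X - C u) * (cubic a b * derivative g)) := by
      simp only [theta_apply, derivative_mul, derivative_pow, derivative_sub, derivative_X,
        derivative_C]
      simp only [Nat.add_sub_cancel, map_natCast]
      ring
    rw [pow_succ, Module.End.mul_apply, key]
    refine ih (by omega) _ ?_
    have h1 : ((s + 1 : ℕ) : L) ≠ 0 := by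
      rw [Ne, CharP.cast_eq_zero_iff L p]
      exact fun h => absurd (Nat.le_of_dvd (by omega) h) (by omega)
    simp only [eval_add, eval_mul, eval_natCast, eval_sub, eval_X, eval_C, sub_self, zero_mul,
      add_zero]
    exact mul_ne_zero (mul_ne_zero h1 hu) hg

lemma le_rootMultiplicity_of_theta (p : ℕ) [CharP L p] {a b u : L} (hu : (cubic a b).eval u ≠ 0)
    {f : L[X]} (hf : f ≠ 0) (hdeg : f.natDegree < p) (M : ℕ)
    (h : ∀ r < M, ((theta a b ^ r) f).eval u = 0) : M ≤ f.rootMultiplicity u := by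
  classical
  by_contra! hlt
  obtain ⟨g, hg, hg'⟩ := exists_eq_pow_rootMultiplicity_mul_and_not_dvd f hf u
  have hs : f.rootMultiplicity u < p := by
    refine lt_of_le_of_lt ?_ hdeg
    rw [← count_roots]
    exact (Multiset.count_le_card _ _).trans (card_roots' _)
  refine eval_theta_pow_ne_zero p hu _ hs g (fun h0 => hg' (dvd_iff_isRoot.mpr h0)) ?_
  rw [← hg]
  exact h _ hlt

/-- The Stepanov method: a bound for the number of `u` for which both `u v` and `v / u` lie in small
groups of roots of unity, where `v = (u - b) / (a u - 1)`. -/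
theorem stepanov_bound (p : ℕ) [CharP L p] {a b : L} (hb : b ≠ 0) (hab : a * b ≠ 1)
    (k m n : ℕ) (hk : 0 < k) (hm : 17 * k ^ 8 ≤ m) (hn : 17 * k ^ 8 ≤ n)
    (hdeg : k ^ 2 + 4 * k * (m + n) < p) (U : Finset L)
    (hU0 : ∀ u ∈ U, (cubic a b).eval u ≠ 0)
    (hUm : ∀ u ∈ U, (u * (u - b)) ^ m = (a * u - 1) ^ m)
    (hUn : ∀ u ∈ U, (u - b) ^ n = (u * (a * u - 1)) ^ n) :
    U.card * k ^ 2 ≤ k ^ 2 + 4 * k * (m + n) := by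
  classical
  set A := k ^ 2 with hA
  set B := 2 * k with hB
  have hN : (A * B ^ 2) ^ 2 + A ≤ 17 * k ^ 8 := by
    have : k ^ 2 ≤ k ^ 8 := Nat.pow_le_pow_right hk (by norm_num)
    have e : (A * B ^ 2) ^ 2 = 16 * k ^ 8 := by rw [hA, hB]; ring
    omega
  have hdeg' : A + 2 * (m + n) * B < p := by
    have : 2 * (m + n) * B = 4 * k * (m + n) := by rw [hB]; ring
    omega
  have hli := linearIndependent_aux p hb hab A B m n (hN.trans hm) (hN.trans hn) hdeg'
  let e := auxExp m n B (A := A)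
  let Q : Fin A → (Fin A × Fin B × Fin B → L) →ₗ[L] L[X] := fun r =>
    Fintype.linearCombination L fun q => X ^ (q.1 : ℕ) * derQuot a b (e q) r
  let T : (Fin A × Fin B × Fin B → L) →ₗ[L] (Fin A × Fin (3 * A) → L) :=
    LinearMap.pi fun x => lcoeff L (x.2 : ℕ) ∘ₗ Q x.1
  have hker : LinearMap.ker T ≠ ⊥ := by
    refine LinearMap.ker_ne_bot_of_finrank_lt ?_
    simp only [Module.finrank_fintype_fun_eq_card, Fintype.card_prod, Fintype.card_fin]
    rw [hA, hB]
    have : 0 < k ^ 4 := by positivity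
    nlinarith
  obtain ⟨c, hc, hc0⟩ := (Submodule.ne_bot_iff _).mp hker
  have hQ : ∀ r, Q r c = 0 := fun r => by
    ext t
    by_cases ht : t < 3 * A
    · exact congrFun (LinearMap.mem_ker.mp hc) (r, ⟨t, ht⟩)
    · rw [coeff_zero]
      refine coeff_eq_zero_of_natDegree_lt (lt_of_le_of_lt ?_
        (show 3 * A - 1 < t by have := r.2; omega))
      simp only [Q, Fintype.linearCombination_apply]
      refine natDegree_sum_le_of_forall_le _ _ fun q _ => (natDegree_smul_le _ _).trans
        (natDegree_mul_le.trans ?_)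
      have h1 := natDegree_derQuot_le a b (e q) r
      have h2 := natDegree_X_pow_le (R := L) (q.1 : ℕ)
      have := r.2
      have := q.1.2
      omega
  let f : L[X] := ∑ q, c q • unitMonomial a b (e q)
  have hf0 : f ≠ 0 := fun h0 => hc0 (funext fun q => Fintype.linearIndependent_iff.mp hli c h0 q)
  have hfdeg : f.natDegree ≤ A + 2 * (m + n) * B :=
    natDegree_sum_le_of_forall_le _ _ fun q _ => (natDegree_smul_le _ _).trans
      ((natDegree_unitMonomial_le _ _ _).trans (auxExp_sum_le m n B q))
  have hmult : ∀ u ∈ U, A ≤ f.rootMultiplicity u := fun u hu => by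
    refine le_rootMultiplicity_of_theta p (hU0 u hu) hf0 (hfdeg.trans_lt hdeg') A fun r hr => ?_
    have hev : ∀ q, (unitMonomial a b (e q)).eval u =
        u ^ (q.1 : ℕ) * ((a * u - 1) ^ (m * (B - 1)) * (u * (a * u - 1)) ^ (n * (B - 1))) := by
      rintro ⟨i, k', l⟩
      have hk' := k'.2
      have hl := l.2
      have e1 : m * (B - 1) = m * l + m * (B - 1 - l) := by rw [← mul_add]; congr 1; omega
      have e2 : n * (B - 1) = n * k' + n * (B - 1 - k') := by rw [← mul_add]; congr 1; omega
      have h1 : (u * (u - b)) ^ (m * (l : ℕ)) = (a * u - 1) ^ (m * (l : ℕ)) := by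
        rw [pow_mul, hUm u hu, pow_mul]
      have h2 : (u - b) ^ (n * (k' : ℕ)) = (u * (a * u - 1)) ^ (n * (k' : ℕ)) := by
        rw [pow_mul, hUn u hu, pow_mul]
      rw [e1, e2, pow_add (a * u - 1), pow_add (u * (a * u - 1)), ← h1, ← h2]
      simp only [e, auxExp, unitMonomial, eval_mul, eval_pow, eval_sub, eval_X, eval_C, eval_one,
        mul_pow, pow_add]
      ring
    have hz := congrArg (eval u) (hQ ⟨r, hr⟩)
    simp only [Q, Fintype.linearCombination_apply, eval_finsetSum, eval_smul, eval_mul, eval_pow,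
      eval_X, eval_zero, smul_eq_mul] at hz
    simp only [f, map_sum, map_smul, theta_pow_unitMonomial, eval_finsetSum, eval_smul, eval_mul,
      hev, smul_eq_mul]
    rw [← mul_zero ((a * u - 1) ^ (m * (B - 1)) * (u * (a * u - 1)) ^ (n * (B - 1))), ← hz,
      Finset.mul_sum]
    exact Finset.sum_congr rfl fun q _ => by ring
  calc U.card * k ^ 2 = ∑ u ∈ U, A := by simp [hA]
    _ ≤ ∑ u ∈ U, f.roots.count u := Finset.sum_le_sum fun u hu => by
        rw [count_roots]; exact hmult u hu
    _ ≤ ∑ u ∈ U ∪ f.roots.toFinset, f.roots.count u :=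
        Finset.sum_le_sum_of_subset Finset.subset_union_left
    _ = f.roots.card := Multiset.sum_count_eq_card fun u hu => by simp [Multiset.mem_toFinset.mpr hu]
    _ ≤ f.natDegree := card_roots' f
    _ ≤ k ^ 2 + 4 * k * (m + n) := hfdeg.trans (le_of_eq (by rw [hA, hB]; ring))

end Stepanov

section Rotation

variable {R : Type*} [CommRing R]

/-- The sequence `w` with `w 0 = y`, `w 1 = z` and `w (j + 2) = s * w (j + 1) - w j`. -/
def rotSeq (s y z : R) : ℕ → R
  | 0 => y
  | 1 => z
  | j + 2 => s * rotSeq s y z (j + 1) - rotSeq s y z j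

@[simp] lemma rotSeq_zero (s y z : R) : rotSeq s y z 0 = y := rfl

@[simp] lemma rotSeq_one (s y z : R) : rotSeq s y z 1 = z := rfl

lemma rotSeq_add_two (s y z : R) (j : ℕ) :
    rotSeq s y z (j + 2) = s * rotSeq s y z (j + 1) - rotSeq s y z j := rfl

lemma map_rotSeq {R' : Type*} [CommRing R'] (f : R →+* R') (s y z : R) (j : ℕ) :
    f (rotSeq s y z j) = rotSeq (f s) (f y) (f z) j := by
  induction j using Nat.strong_induction_on with
  | _ j ih =>
    match j with
    | 0 => rfl
    | 1 => rfl
    | j + 2 => rw [rotSeq_add_two, rotSeq_add_two, map_sub, map_mul, ih _ (by omega),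
        ih _ (by omega)]

lemma rotSeq_eq_of_closed_form {K : Type*} [Field K] {x t t' s y z : K} (hx0 : x ≠ 0)
    (hs : x + x⁻¹ = s) (hy : y = t + t') (hz : z = t * x + t' * x⁻¹) (j : ℕ) :
    rotSeq s y z j = t * x ^ j + t' * x⁻¹ ^ j := by
  induction j using Nat.strong_induction_on with
  | _ j ih =>
    match j with
    | 0 => simp [hy]
    | 1 => simp [hz]
    | j + 2 =>
      rw [rotSeq_add_two, ih _ (by omega), ih _ (by omega), ← hs]
      linear_combination (t * x ^ j + t' * x⁻¹ ^ j) * mul_inv_cancel₀ hx0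

lemma exists_closed_form {K : Type*} [Field K] {x s : K} (hx0 : x ≠ 0) (hx : x ^ 2 ≠ 1)
    (hs : x + x⁻¹ = s) (y z : K) :
    ∃ t t' : K, y = t + t' ∧ z = t * x + t' * x⁻¹ ∧
      t * t' * (s ^ 2 - 4) = s * y * z - y ^ 2 - z ^ 2 := by
  have h1 : x ^ 2 - 1 ≠ 0 := sub_ne_zero.mpr hx
  refine ⟨(z * x - y) / (x ^ 2 - 1), (y * x ^ 2 - z * x) / (x ^ 2 - 1), ?_, ?_, ?_⟩
  · field_simp; ring
  · field_simp; ring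
  · rw [← hs]; field_simp; ring

end Rotation

section Chi

variable (p : ℕ) [Fact p.Prime]

/-- An algebraic closure of `ZMod p`. -/
abbrev Fbar : Type := AlgebraicClosure (ZMod p)

instance : CharP (Fbar p) p := charP_of_injective_algebraMap (algebraMap (ZMod p) _).injective p

variable {p}

lemma exists_add_inv_eq {K : Type*} [Field K] [IsAlgClosed K] (s : K) :
    ∃ x : K, x ≠ 0 ∧ x + x⁻¹ = s := by
  obtain ⟨x, hx⟩ := IsAlgClosed.exists_root (X ^ 2 - C s * X + 1 : K[X]) (by
    have : (X ^ 2 - C s * X + 1 : K[X]).degree = 2 := by compute_degree!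
    rw [this]; decide)
  simp only [IsRoot.def, eval_add, eval_sub, eval_pow, eval_X, eval_mul, eval_C, eval_one] at hx
  have hx0 : x ≠ 0 := by rintro rfl; simp at hx
  refine ⟨x, hx0, ?_⟩
  field_simp
  linear_combination hx

lemma eq_or_eq_inv_of_add_inv_eq {K : Type*} [Field K] {x y : K} (hx : x ≠ 0) (hy : y ≠ 0)
    (h : x + x⁻¹ = y + y⁻¹) : x = y ∨ x = y⁻¹ := by
  have : (x - y) * (x * y - 1) = 0 := by
    field_simp at h
    linear_combination h
  rcases mul_eq_zero.mp this with h | h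
  · exact Or.inl (sub_eq_zero.mp h)
  · exact Or.inr (eq_inv_of_mul_eq_one_left (sub_eq_zero.mp h))

/-- An element `x` of the algebraic closure with `x + x⁻¹ = s`. -/
noncomputable def chi (s : ZMod p) : Fbar p :=
  (exists_add_inv_eq (algebraMap (ZMod p) (Fbar p) s)).choose

lemma chi_ne_zero (s : ZMod p) : chi s ≠ 0 :=
  (exists_add_inv_eq (algebraMap (ZMod p) (Fbar p) s)).choose_spec.1

lemma chi_add_inv (s : ZMod p) : chi s + (chi s)⁻¹ = algebraMap (ZMod p) (Fbar p) s :=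
  (exists_add_inv_eq (algebraMap (ZMod p) (Fbar p) s)).choose_spec.2

/-- The multiplicative order of `chi s`. -/
noncomputable def mord (s : ZMod p) : ℕ := orderOf (chi s)

lemma chi_injective : Function.Injective (chi : ZMod p → Fbar p) := fun s t h =>
  (algebraMap (ZMod p) (Fbar p)).injective (by rw [← chi_add_inv, ← chi_add_inv, h])

lemma eq_chi_or_eq_inv {x : Fbar p} (hx : x ≠ 0) {s : ZMod p}
    (h : x + x⁻¹ = algebraMap (ZMod p) (Fbar p) s) : x = chi s ∨ x = (chi s)⁻¹ :=
  eq_or_eq_inv_of_add_inv_eq hx (chi_ne_zero s) (h.trans (chi_add_inv s).symm)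

lemma orderOf_inv_eq {K : Type*} [Field K] (x : K) : orderOf x⁻¹ = orderOf x := by
  refine orderOf_eq_orderOf_iff.mpr fun n => ?_
  rw [inv_pow, inv_eq_one]

lemma orderOf_eq_mord {x : Fbar p} (hx : x ≠ 0) {s : ZMod p}
    (h : x + x⁻¹ = algebraMap (ZMod p) (Fbar p) s) : orderOf x = mord s := by
  rcases eq_chi_or_eq_inv hx h with h | h
  · rw [h, mord]
  · rw [h, orderOf_inv_eq, mord]

lemma chi_pow_prime (s : ZMod p) : chi s ^ p = chi s ∨ chi s ^ p = (chi s)⁻¹ := by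
  refine eq_chi_or_eq_inv (pow_ne_zero _ (chi_ne_zero s)) ?_
  rw [← inv_pow, ← add_pow_char, chi_add_inv, ← map_pow, ZMod.pow_card]

lemma mord_dvd_sub_or_dvd_add (s : ZMod p) : mord s ∣ p - 1 ∨ mord s ∣ p + 1 := by
  have hp := (Fact.out : p.Prime).pos
  rcases chi_pow_prime s with h | h
  · refine Or.inl (orderOf_dvd_of_pow_eq_one ?_)
    refine mul_right_cancel₀ (chi_ne_zero s) ?_
    rw [← pow_succ, Nat.sub_add_cancel hp, h, one_mul]
  · refine Or.inr (orderOf_dvd_of_pow_eq_one ?_)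
    rw [pow_succ, h, inv_mul_cancel₀ (chi_ne_zero s)]

lemma mord_dvd (s : ZMod p) : mord s ∣ p ^ 2 - 1 := by
  have : p ^ 2 - 1 = (p + 1) * (p - 1) := by simpa using Nat.sq_sub_sq p 1
  rw [this]
  rcases mord_dvd_sub_or_dvd_add s with h | h
  · exact h.mul_left _
  · exact h.mul_right _

lemma sq_sub_one_pos : 0 < p ^ 2 - 1 := by
  have := (Fact.out : p.Prime).two_le
  have : 2 ^ 2 ≤ p ^ 2 := Nat.pow_le_pow_left this 2
  omega

lemma mord_pos (s : ZMod p) : 0 < mord s := Nat.pos_of_dvd_of_pos (mord_dvd s) sq_sub_one_pos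

lemma chi_pow_mord (s : ZMod p) : chi s ^ mord s = 1 := pow_orderOf_eq_one _

lemma card_mord_eq_le (n : ℕ) (A : Finset (ZMod p)) (hA : ∀ s ∈ A, mord s = n) :
    A.card ≤ n := by
  classical
  rcases Nat.eq_zero_or_pos n with rfl | hn
  · rw [Nat.le_zero, Finset.card_eq_zero]
    refine Finset.eq_empty_of_forall_notMem fun s hs => ?_
    exact (mord_pos s).ne' (hA s hs)
  · calc A.card = (A.image chi).card := (Finset.card_image_of_injective _ chi_injective).symm
      _ ≤ (nthRoots n (1 : Fbar p)).toFinset.card := by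
        refine Finset.card_le_card fun x hx => ?_
        obtain ⟨s, hs, rfl⟩ := Finset.mem_image.mp hx
        rw [Multiset.mem_toFinset, mem_nthRoots hn, ← hA s hs, chi_pow_mord]
      _ ≤ (nthRoots n (1 : Fbar p)).card := Multiset.toFinset_card_le _
      _ ≤ n := card_nthRoots n 1

lemma chi_sq_ne_one {s : ZMod p} (h : 2 < mord s) : chi s ^ 2 ≠ 1 := fun h0 =>
  absurd (Nat.le_of_dvd (by norm_num) (orderOf_dvd_of_pow_eq_one h0)) (by rw [← mord]; omega)

lemma ne_zero_of_four_lt_mord {s : ZMod p} (h : 4 < mord s) : s ≠ 0 := by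
  rintro rfl
  have h1 := chi_add_inv (0 : ZMod p)
  rw [map_zero] at h1
  have hx := chi_ne_zero (0 : ZMod p)
  have h2 : chi (0 : ZMod p) ^ 2 = -1 := by
    field_simp at h1
    linear_combination h1
  have h4 : chi (0 : ZMod p) ^ 4 = 1 := by
    rw [show 4 = 2 * 2 from rfl, pow_mul, h2]; norm_num
  exact absurd (Nat.le_of_dvd (by norm_num) (orderOf_dvd_of_pow_eq_one h4)) (by rw [← mord]; omega)

end Chi

/-- A set of solutions of `x² + y² + z² = x y z`, stable under the coordinate permutations and the
Vieta involutions. -/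
structure IsInvariant {R : Type*} [CommRing R] (S : R → R → R → Prop) : Prop where
  eqn : ∀ {x y z}, S x y z → x ^ 2 + y ^ 2 + z ^ 2 = x * y * z
  swap₁₂ : ∀ {x y z}, S x y z → S y x z
  swap₂₃ : ∀ {x y z}, S x y z → S x z y
  vieta : ∀ {x y z}, S x y z → S x y (x * y - z)

lemma IsInvariant.rotSeq {R : Type*} [CommRing R] {S : R → R → R → Prop} (hS : IsInvariant S)
    {x y z : R} (h : S x y z) (j : ℕ) : S x (rotSeq x y z j) (rotSeq x y z (j + 1)) := by
  induction j with
  | zero => exact h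
  | succ j ih => rw [rotSeq_add_two]; exact hS.vieta (hS.swap₂₃ ih)

section Fiber

variable {p : ℕ} [Fact p.Prime]

lemma IsInvariant.exists_fiber (hp : 2 < p) {S : ZMod p → ZMod p → ZMod p → Prop}
    (hS : IsInvariant S) {x y z : ZMod p} (h : S x y z) (hx : 4 < mord x) :
    ∃ t t' : Fbar p, t ≠ 0 ∧ t' ≠ 0 ∧ t * t' ≠ 1 ∧
      t * t' * (algebraMap (ZMod p) (Fbar p) x ^ 2 - 4) = algebraMap (ZMod p) (Fbar p) x ^ 2 ∧
      ∀ j, algebraMap (ZMod p) (Fbar p) (MarkoffOrbit.rotSeq x y z j) =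
        t * chi x ^ j + t' * (chi x)⁻¹ ^ j := by
  set φ := algebraMap (ZMod p) (Fbar p)
  obtain ⟨t, t', h1, h2, h3⟩ := exists_closed_form (chi_ne_zero x) (chi_sq_ne_one (by omega))
    (chi_add_inv x) (φ y) (φ z)
  have hx0 : φ x ^ 2 ≠ 0 := pow_ne_zero 2 (by simpa [φ] using ne_zero_of_four_lt_mord hx)
  have e : φ x * φ y * φ z - φ y ^ 2 - φ z ^ 2 = φ x ^ 2 := by
    have := congrArg φ (hS.eqn h)
    simp only [map_add, map_mul, map_pow] at this
    linear_combination -this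
  rw [e] at h3
  refine ⟨t, t', ?_, ?_, ?_, h3, fun j => ?_⟩
  · rintro rfl; exact hx0 (by rw [← h3]; ring)
  · rintro rfl; exact hx0 (by rw [← h3]; ring)
  · intro h4
    rw [h4] at h3
    have h5 : ((2 ^ 2 : ℕ) : Fbar p) = 0 := by push_cast; linear_combination -h3
    rw [CharP.cast_eq_zero_iff (Fbar p) p] at h5
    exact absurd (Nat.le_of_dvd (by norm_num) ((Fact.out : p.Prime).dvd_of_dvd_pow h5)) (by omega)
  · rw [map_rotSeq]
    exact rotSeq_eq_of_closed_form (chi_ne_zero x) (chi_add_inv x) h1 h2 j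

lemma pow_injOn_range {K : Type*} [Field K] {x : K} :
    Set.InjOn (fun j => x ^ j) (Finset.range (orderOf x)) := fun i hi j hj h =>
  pow_injOn_Iio_orderOf (by simpa using hi) (by simpa using hj) h

lemma card_mul_pow_eq_le_two {K : Type*} [Field K] {t x : K} (ht : t ≠ 0) (α β : K)
    (J : Finset ℕ) (hJ : J ⊆ Finset.range (orderOf x))
    (h : ∀ j ∈ J, (t * x ^ j) ^ 2 - α * (t * x ^ j) + β = 0) : J.card ≤ 2 := by
  classical
  have hinj : Set.InjOn (fun j => t * x ^ j) J := fun i hi j hj hij =>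
    pow_injOn_range (hJ hi) (hJ hj) (mul_left_cancel₀ ht hij)
  rw [← Finset.card_image_of_injOn hinj]
  let f : K[X] := X ^ 2 - C α * X + C β
  have hdeg : f.natDegree = 2 := by simp only [f]; compute_degree!
  have hne : f ≠ 0 := fun h0 => by simp [h0] at hdeg
  have hsub : J.image (fun j => t * x ^ j) ⊆ f.roots.toFinset := fun r hr => by
    obtain ⟨j, hj, rfl⟩ := Finset.mem_image.mp hr
    rw [Multiset.mem_toFinset, mem_roots hne]
    simpa [f] using h j hj
  exact (Finset.card_le_card hsub).trans ((Multiset.toFinset_card_le _).trans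
    ((card_roots' f).trans hdeg.le))

lemma card_rotSeq_eq_le_two {x y z : ZMod p} {t t' : Fbar p} (ht : t ≠ 0)
    (h : ∀ j, algebraMap (ZMod p) (Fbar p) (rotSeq x y z j) = t * chi x ^ j + t' * (chi x)⁻¹ ^ j)
    (v : ZMod p) (J : Finset ℕ) (hJ : J ⊆ Finset.range (mord x))
    (hv : ∀ j ∈ J, rotSeq x y z j = v) : J.card ≤ 2 := by
  refine card_mul_pow_eq_le_two ht (algebraMap (ZMod p) (Fbar p) v) (t * t') J hJ fun j hj => ?_
  have e : chi x ^ j * (chi x)⁻¹ ^ j = 1 := by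
    rw [← mul_pow, mul_inv_cancel₀ (chi_ne_zero x), one_pow]
  rw [← hv j hj, h j]
  linear_combination (-t * t') * e

end Fiber

section MiddleGame

variable {p : ℕ} [Fact p.Prime]

/-- On the fiber over `x`, few elements have a prescribed small order `n`. -/
theorem IsInvariant.card_mord_rotSeq_eq_mul_le (hp : 2 < p) {S : ZMod p → ZMod p → ZMod p → Prop}
    (hS : IsInvariant S) {x y z : ZMod p} (h : S x y z) (hx : 4 < mord x) {k n : ℕ} (hk : 0 < k)
    (hm : 17 * k ^ 8 ≤ mord x) (hn : 17 * k ^ 8 ≤ n) (hdeg : k ^ 2 + 4 * k * (mord x + n) < p)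
    (J : Finset ℕ) (hJ : J ⊆ Finset.range (mord x))
    (hJn : ∀ j ∈ J, mord (MarkoffOrbit.rotSeq x y z j) = n) :
    J.card * k ^ 2 ≤ 2 * (k ^ 2 + 4 * k * (mord x + n)) := by
  classical
  obtain ⟨a, b, ha, hb, hab, -, hform⟩ := hS.exists_fiber hp h hx
  let u : ℕ → Fbar p := fun j => chi x ^ j / chi (MarkoffOrbit.rotSeq x y z j)
  let v : ℕ → Fbar p := fun j => chi x ^ j * chi (MarkoffOrbit.rotSeq x y z j)
  have hX : ∀ j, chi x ^ j ≠ 0 := fun j => pow_ne_zero _ (chi_ne_zero x)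
  have hu0 : ∀ j, u j ≠ 0 := fun j => div_ne_zero (hX j) (chi_ne_zero _)
  have hv0 : ∀ j, v j ≠ 0 := fun j => mul_ne_zero (hX j) (chi_ne_zero _)
  have huv : ∀ j, u j * v j = (chi x ^ j) ^ 2 := fun j => by
    have := chi_ne_zero (MarkoffOrbit.rotSeq x y z j)
    simp only [u, v]; field_simp
  have hvu : ∀ j, v j = u j * chi (MarkoffOrbit.rotSeq x y z j) ^ 2 := fun j => by
    have := chi_ne_zero (MarkoffOrbit.rotSeq x y z j)
    simp only [u, v]; field_simp
  have hlin : ∀ j, v j * (a * u j - 1) = u j - b := fun j => by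
    have h1 : a * chi x ^ j + b * (chi x)⁻¹ ^ j = chi (MarkoffOrbit.rotSeq x y z j) +
        (chi (MarkoffOrbit.rotSeq x y z j))⁻¹ := by rw [← hform, chi_add_inv]
    have h2 : u j + v j = a * (u j * v j) + b := by
      rw [huv]
      have e : chi x ^ j * (chi x)⁻¹ ^ j = 1 := by
        rw [← mul_pow, mul_inv_cancel₀ (chi_ne_zero x), one_pow]
      have e2 : u j + v j = chi x ^ j * (chi (MarkoffOrbit.rotSeq x y z j) +
          (chi (MarkoffOrbit.rotSeq x y z j))⁻¹) := by
        simp only [u, v]; rw [div_eq_mul_inv]; ring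
      rw [e2, ← h1]
      linear_combination b * e
    linear_combination -h2
  have hau : ∀ j, a * u j - 1 ≠ 0 := fun j h0 => by
    have h1 := hlin j
    rw [h0, mul_zero] at h1
    exact hab (by linear_combination h0 + a * h1)
  have hcard : J.card ≤ 2 * (J.image u).card := by
    refine Finset.card_le_mul_card_image _ _ fun w _ => ?_
    refine card_mul_pow_eq_le_two (t := 1) (x := chi x) one_ne_zero 0
      (-(w * ((w - b) / (a * w - 1)))) _ ((Finset.filter_subset _ _).trans hJ) fun j hj => ?_
    obtain ⟨-, rfl⟩ := Finset.mem_filter.mp hj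
    have : (u j - b) / (a * u j - 1) = v j := by rw [← hlin, mul_div_cancel_right₀ _ (hau j)]
    rw [this, huv]
    ring
  have hst := stepanov_bound p hb hab k (mord x) n hk hm hn hdeg (J.image u)
    (by
      intro w hw
      obtain ⟨j, hj, rfl⟩ := Finset.mem_image.mp hw
      simp only [cubic, eval_mul, eval_sub, eval_X, eval_C, eval_one]
      refine mul_ne_zero (mul_ne_zero (hu0 j) ?_) (hau j)
      rw [← hlin]
      exact mul_ne_zero (hv0 j) (hau j))
    (by
      intro w hw
      obtain ⟨j, hj, rfl⟩ := Finset.mem_image.mp hw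
      rw [← hlin, ← mul_assoc, huv, mul_pow, ← pow_mul, ← pow_mul,
        show j * (2 * mord x) = mord x * (j * 2) by ring, pow_mul, chi_pow_mord, one_pow, one_mul])
    (by
      intro w hw
      obtain ⟨j, hj, rfl⟩ := Finset.mem_image.mp hw
      rw [← hlin, hvu j, mul_pow, mul_pow, mul_pow, ← pow_mul, mul_comm 2 n, pow_mul, ← hJn j hj,
        chi_pow_mord, one_pow, mul_one])
  nlinarith

lemma IsInvariant.card_mord_rotSeq_eq_le (hp : 2 < p) {S : ZMod p → ZMod p → ZMod p → Prop}
    (hS : IsInvariant S) {x y z : ZMod p} (h : S x y z) (hx : 4 < mord x) (n : ℕ)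
    (J : Finset ℕ) (hJ : J ⊆ Finset.range (mord x))
    (hJn : ∀ j ∈ J, mord (MarkoffOrbit.rotSeq x y z j) = n) : J.card ≤ 2 * n := by
  classical
  obtain ⟨a, b, ha, hb, hab, -, hform⟩ := hS.exists_fiber hp h hx
  calc J.card ≤ 2 * (J.image (MarkoffOrbit.rotSeq x y z)).card := by
        refine Finset.card_le_mul_card_image _ _ fun w _ => ?_
        exact card_rotSeq_eq_le_two ha hform w _ ((Finset.filter_subset _ _).trans hJ)
          fun j hj => (Finset.mem_filter.mp hj).2
    _ ≤ 2 * n := by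
        gcongr
        refine card_mord_eq_le n _ fun s hs => ?_
        obtain ⟨j, hj, rfl⟩ := Finset.mem_image.mp hs
        exact hJn j hj

lemma IsInvariant.exists_mord_lt (hp : 2 < p) {S : ZMod p → ZMod p → ZMod p → Prop}
    (hS : IsInvariant S) {x y z : ZMod p} (h : S x y z) {k : ℕ}
    (hk : 18 * (p ^ 2 - 1).divisors.card < k) (hm : 17 * k ^ 9 ≤ mord x)
    (hdeg : k ^ 2 + 8 * mord x * k < p) : ∃ x' y' z', S x' y' z' ∧ mord x < mord x' := by
  classical
  by_contra! hcon
  have hk0 : 0 < k := by omega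
  have hk9 : k ^ 8 ≤ k ^ 9 := Nat.pow_le_pow_right hk0 (by norm_num)
  have hk8 : k ≤ k ^ 8 := Nat.le_self_pow (by norm_num) k
  have hx : 4 < mord x := by omega
  have hkm : k ≤ mord x := by omega
  have hle : ∀ j, mord (MarkoffOrbit.rotSeq x y z j) ≤ mord x := fun j =>
    hcon _ _ _ (hS.swap₁₂ (hS.rotSeq h j))
  have hbound : ∀ n ∈ (p ^ 2 - 1).divisors,
      ((Finset.range (mord x)).filter fun j => mord (MarkoffOrbit.rotSeq x y z j) = n).card * k ≤
        18 * mord x := fun n _ => by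
    set J := (Finset.range (mord x)).filter fun j => mord (MarkoffOrbit.rotSeq x y z j) = n
    have hJ : J ⊆ Finset.range (mord x) := Finset.filter_subset _ _
    have hJn : ∀ j ∈ J, mord (MarkoffOrbit.rotSeq x y z j) = n := fun j hj =>
      (Finset.mem_filter.mp hj).2
    rcases J.eq_empty_or_nonempty with h0 | ⟨j₀, hj₀⟩
    · simp [h0]
    have hnm : n ≤ mord x := hJn j₀ hj₀ ▸ hle j₀
    rcases lt_or_ge (n * k) (mord x) with hlt | hge
    · have := hS.card_mord_rotSeq_eq_le hp h hx n J hJ hJn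
      nlinarith
    · have hn : 17 * k ^ 8 ≤ n := by
        refine Nat.le_of_mul_le_mul_right ?_ hk0
        calc 17 * k ^ 8 * k = 17 * k ^ 9 := by ring
          _ ≤ n * k := hm.trans hge
      have hd : k ^ 2 + 4 * k * (mord x + n) ≤ k ^ 2 + 8 * mord x * k := by nlinarith
      have := hS.card_mord_rotSeq_eq_mul_le hp h hx hk0 (by omega) hn (hd.trans_lt hdeg) J hJ hJn
      refine Nat.le_of_mul_le_mul_right ?_ hk0
      calc J.card * k * k = J.card * k ^ 2 := by ring
        _ ≤ 2 * (k ^ 2 + 8 * mord x * k) := by omega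
        _ ≤ 18 * mord x * k := by nlinarith
  have hsum : mord x * k ≤ (p ^ 2 - 1).divisors.card * (18 * mord x) := by
    calc mord x * k = (∑ n ∈ (p ^ 2 - 1).divisors, ((Finset.range (mord x)).filter
          fun j => mord (MarkoffOrbit.rotSeq x y z j) = n).card) * k := by
          rw [← Finset.card_eq_sum_card_fiberwise, Finset.card_range]
          intro j _
          exact Nat.mem_divisors.mpr ⟨mord_dvd _, sq_sub_one_pos.ne'⟩
      _ ≤ ∑ n ∈ (p ^ 2 - 1).divisors, 18 * mord x := by
          rw [Finset.sum_mul]; exact Finset.sum_le_sum hbound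
      _ = _ := by simp
  have hpos := mord_pos x
  nlinarith

theorem IsInvariant.exists_le_mord (hp : 2 < p) {S : ZMod p → ZMod p → ZMod p → Prop}
    (hS : IsInvariant S) {k : ℕ} (hk : 18 * (p ^ 2 - 1).divisors.card < k) {x y z : ZMod p}
    (h : S x y z) (hm : 17 * k ^ 9 ≤ mord x) :
    ∃ x' y' z', S x' y' z' ∧ 17 * k ^ 9 ≤ mord x' ∧ p ≤ k ^ 2 + 8 * mord x' * k := by
  have hle : ∀ s : ZMod p, mord s ≤ p ^ 2 - 1 := fun s =>
    Nat.le_of_dvd sq_sub_one_pos (mord_dvd s)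
  induction hN : p ^ 2 - 1 - mord x using Nat.strong_induction_on generalizing x y z with
  | _ N ih =>
    by_cases hdeg : k ^ 2 + 8 * mord x * k < p
    · obtain ⟨x', y', z', h', hlt⟩ := hS.exists_mord_lt hp h hk hm hdeg
      have := hle x'
      exact ih (p ^ 2 - 1 - mord x') (by omega) h' (by omega) rfl
    · exact ⟨x, y, z, h, hm, not_lt.mp hdeg⟩

end MiddleGame

section Mixing

/-- A second moment bound: if the functions `f j` are nearly pairwise independent, then few points
avoid `G` under all of them. -/
theorem card_mul_le_of_pairwise {W F : Type*} [Fintype W] [DecidableEq F] {q : ℕ}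
    (hW : Fintype.card W = q ^ 2) (d : ℕ) (f : ℕ → W → F) (G : Finset F)
    (h1 : ∀ j < d, (Finset.univ.filter fun w => f j w ∈ G).card = q * G.card)
    (h2 : ∀ j < d, ∃ B : Finset ℕ, B.card ≤ 2 ∧ ∀ i < d, i ∉ B →
      Function.Injective fun w => (f j w, f i w))
    (Φ : Finset W) (hΦ : ∀ w ∈ Φ, ∀ j < d, f j w ∉ G) :
    Φ.card * d * G.card ≤ 2 * q ^ 3 := by
  classical
  let I : ℕ → W → ℤ := fun j w => if f j w ∈ G then 1 else 0
  let c : W → ℤ := fun w => ∑ j ∈ Finset.range d, I j w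
  have hsum : ∑ w, c w = d * (q * G.card) := by
    simp only [c]
    rw [Finset.sum_comm, Finset.sum_congr rfl (g := fun _ => (q * G.card : ℤ))]
    · simp
    · intro j hj
      simp only [I, Finset.sum_boole]
      rw [h1 j (Finset.mem_range.mp hj)]
      push_cast; rfl
  have hpair : ∀ j < d, ∀ i, ∑ w, I j w * I i w ≤ q * G.card := fun j hj i => by
    calc ∑ w, I j w * I i w ≤ ∑ w, I j w := Finset.sum_le_sum fun w _ => by
          simp only [I]; split_ifs <;> simp
      _ = _ := by
          simp only [I, Finset.sum_boole]
          rw [h1 j hj]; push_cast; rfl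
  have hpair' : ∀ j i, Function.Injective (fun w => (f j w, f i w)) →
      ∑ w, I j w * I i w ≤ (G.card : ℤ) ^ 2 := fun j i hinj => by
    have : ∀ w, I j w * I i w = if f j w ∈ G ∧ f i w ∈ G then 1 else 0 := fun w => by
      simp only [I]; split_ifs <;> simp_all
    simp only [this, Finset.sum_boole]
    have h3 : ((Finset.univ.filter fun w => f j w ∈ G ∧ f i w ∈ G).image
        fun w => (f j w, f i w)) ⊆ G ×ˢ G := fun x hx => by
      obtain ⟨w, hw, rfl⟩ := Finset.mem_image.mp hx
      exact Finset.mem_product.mpr (Finset.mem_filter.mp hw).2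
    have h4 := Finset.card_le_card h3
    rw [Finset.card_image_of_injective _ hinj, Finset.card_product] at h4
    rw [sq]
    exact_mod_cast h4
  have hrow : ∀ j < d, ∑ i ∈ Finset.range d, ∑ w, I j w * I i w ≤
      d * (G.card : ℤ) ^ 2 + 2 * (q * G.card) := fun j hj => by
    obtain ⟨B, hB, hBinj⟩ := h2 j hj
    calc ∑ i ∈ Finset.range d, ∑ w, I j w * I i w
        ≤ ∑ i ∈ Finset.range d, ((G.card : ℤ) ^ 2 + if i ∈ B then (q * G.card : ℤ) else 0) :=
          Finset.sum_le_sum fun i hi => by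
            split_ifs with h
            · have := hpair j hj i
              have := sq_nonneg (G.card : ℤ)
              linarith
            · rw [add_zero]
              exact hpair' j i (hBinj i (Finset.mem_range.mp hi) h)
      _ = d * (G.card : ℤ) ^ 2 +
          ((Finset.range d).filter (· ∈ B)).card * (q * G.card : ℤ) := by
          rw [Finset.sum_add_distrib, ← Finset.sum_filter]; simp
      _ ≤ _ := by
          have h3 : ((Finset.range d).filter (· ∈ B)).card ≤ 2 :=
            (Finset.card_le_card fun i hi => (Finset.mem_filter.mp hi).2).trans hB
          have h3' : (((Finset.range d).filter (· ∈ B)).card : ℤ) ≤ 2 := by exact_mod_cast h3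
          gcongr
  have hsq : ∑ w, c w ^ 2 ≤ d * (d * (G.card : ℤ) ^ 2 + 2 * (q * G.card)) := by
    calc ∑ w, c w ^ 2 = ∑ j ∈ Finset.range d, ∑ i ∈ Finset.range d, ∑ w, I j w * I i w := by
          simp only [c, sq, Finset.sum_mul_sum]
          rw [Finset.sum_comm]
          exact Finset.sum_congr rfl fun j _ => Finset.sum_comm
      _ ≤ ∑ j ∈ Finset.range d, (d * (G.card : ℤ) ^ 2 + 2 * (q * G.card)) :=
          Finset.sum_le_sum fun j hj => hrow j (Finset.mem_range.mp hj)
      _ = _ := by simp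
  have hvar : ∑ w, (q * c w - d * G.card) ^ 2 ≤ 2 * (q : ℤ) ^ 3 * (d * G.card) := by
    have e : ∀ w, (q * c w - d * G.card : ℤ) ^ 2 =
        q ^ 2 * c w ^ 2 - 2 * q * d * G.card * c w + d ^ 2 * G.card ^ 2 := fun w => by ring
    simp only [e, Finset.sum_add_distrib, Finset.sum_sub_distrib, ← Finset.mul_sum, hsum]
    rw [Finset.sum_const, Finset.card_univ, hW, nsmul_eq_mul]
    have := mul_le_mul_of_nonneg_left hsq (sq_nonneg (q : ℤ))
    push_cast
    linarith
  have hΦsum : (Φ.card : ℤ) * (d * G.card) ^ 2 ≤ 2 * (q : ℤ) ^ 3 * (d * G.card) := by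
    calc (Φ.card : ℤ) * (d * G.card) ^ 2 = ∑ w ∈ Φ, (q * c w - d * G.card : ℤ) ^ 2 := by
          rw [Finset.sum_congr rfl (g := fun _ => (d * G.card : ℤ) ^ 2)]
          · simp
          · intro w hw
            have : c w = 0 := Finset.sum_eq_zero fun j hj =>
              if_neg (hΦ w hw j (Finset.mem_range.mp hj))
            rw [this]; ring
      _ ≤ ∑ w, (q * c w - d * G.card : ℤ) ^ 2 :=
          Finset.sum_le_univ_sum_of_nonneg fun w => sq_nonneg _
      _ ≤ _ := hvar
  rcases Nat.eq_zero_or_pos (d * G.card) with h0 | hpos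
  · rw [mul_assoc, h0, mul_zero]; exact Nat.zero_le _
  · have hpos' : (0 : ℤ) < d * G.card := by exact_mod_cast hpos
    have : (Φ.card : ℤ) * d * G.card ≤ 2 * q ^ 3 := by
      refine le_of_mul_le_mul_right ?_ hpos'
      calc _ = (Φ.card : ℤ) * (d * G.card) ^ 2 := by ring
        _ ≤ _ := hΦsum
    exact_mod_cast this

variable {p : ℕ} [Fact p.Prime]

lemma rotSeq_injective_pair {x : Fbar p} {s : ZMod p} (hx0 : x ≠ 0) (hx : x ^ 2 ≠ 1)
    (hs : x + x⁻¹ = algebraMap (ZMod p) (Fbar p) s) {i j : ℕ} (hij : (x ^ i) ^ 2 ≠ (x ^ j) ^ 2) :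
    Function.Injective fun w : ZMod p × ZMod p => (rotSeq s w.1 w.2 j, rotSeq s w.1 w.2 i) := by
  intro w w' h
  set φ := algebraMap (ZMod p) (Fbar p)
  obtain ⟨t, t', h1, h2, -⟩ := exists_closed_form hx0 hx hs (φ w.1) (φ w.2)
  obtain ⟨r, r', h1', h2', -⟩ := exists_closed_form hx0 hx hs (φ w'.1) (φ w'.2)
  have hj := congrArg φ (Prod.ext_iff.mp h).1
  have hi := congrArg φ (Prod.ext_iff.mp h).2
  simp only [map_rotSeq] at hi hj
  change rotSeq (φ s) _ _ _ = rotSeq (φ s) _ _ _ at hi hj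
  rw [rotSeq_eq_of_closed_form hx0 hs h1 h2, rotSeq_eq_of_closed_form hx0 hs h1' h2'] at hi hj
  have hi0 := pow_ne_zero i hx0
  have hj0 := pow_ne_zero j hx0
  rw [inv_pow] at hi hj
  generalize x ^ i = a at *
  generalize x ^ j = b at *
  have hi' : (t - r) * a ^ 2 + (t' - r') = 0 := by
    have := mul_inv_cancel₀ hi0
    linear_combination a * hi - (t' - r') * this
  have hj' : (t - r) * b ^ 2 + (t' - r') = 0 := by
    have := mul_inv_cancel₀ hj0
    linear_combination b * hj - (t' - r') * this
  have e : (t - r) * (a ^ 2 - b ^ 2) = 0 := by linear_combination hi' - hj'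
  have e1 : t = r := sub_eq_zero.mp ((mul_eq_zero.mp e).resolve_right (sub_ne_zero.mpr hij))
  have e2 : t' = r' := by rw [e1] at hi'; linear_combination hi'
  subst e1 e2
  exact Prod.ext ((algebraMap (ZMod p) (Fbar p)).injective (h1.trans h1'.symm))
    ((algebraMap (ZMod p) (Fbar p)).injective (h2.trans h2'.symm))

theorem rotSeq_mixing {x : Fbar p} {s : ZMod p} (hx0 : x ≠ 0) (hx : 2 < orderOf x)
    (hs : x + x⁻¹ = algebraMap (ZMod p) (Fbar p) s) (Φ : Finset (ZMod p × ZMod p))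
    (G : Finset (ZMod p)) (hΦ : ∀ w ∈ Φ, ∀ j < orderOf x, rotSeq s w.1 w.2 j ∉ G) :
    Φ.card * orderOf x * G.card ≤ 2 * p ^ 3 := by
  classical
  have hx2 : x ^ 2 ≠ 1 := fun h0 =>
    absurd (Nat.le_of_dvd (by norm_num) (orderOf_dvd_of_pow_eq_one h0)) (by omega)
  refine card_mul_le_of_pairwise (by simp [ZMod.card, sq]) _ (fun j w => rotSeq s w.1 w.2 j) G
    (fun j _ => ?_) (fun j _ => ?_) Φ hΦ
  · have hinj := rotSeq_injective_pair hx0 hx2 hs (i := j + 1) (j := j) (fun h0 => hx2 (by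
      have h3 := pow_ne_zero 2 (pow_ne_zero j hx0)
      refine mul_left_cancel₀ h3 ?_
      linear_combination h0))
    have hbij := (Finite.injective_iff_bijective).mp hinj
    have e : (Finset.univ.filter fun w : ZMod p × ZMod p => rotSeq s w.1 w.2 j ∈ G).map
        (Equiv.ofBijective _ hbij).toEmbedding = G ×ˢ Finset.univ := by
      ext ⟨a, b⟩
      rw [Finset.mem_map_equiv, Finset.mem_filter, Finset.mem_product]
      have := (Equiv.ofBijective _ hbij).apply_symm_apply (a, b)
      have := (Prod.ext_iff.mp this).1
      simp only [Equiv.ofBijective_apply] at this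
      simp [this]
    rw [← Finset.card_map (Equiv.ofBijective _ hbij).toEmbedding, e, Finset.card_product,
      Finset.card_univ, ZMod.card, mul_comm]
  · refine ⟨(Finset.range (orderOf x)).filter fun i => (x ^ i) ^ 2 = (x ^ j) ^ 2, ?_,
      fun i hi hiB => ?_⟩
    · refine card_mul_pow_eq_le_two (t := 1) one_ne_zero 0 (-(x ^ j) ^ 2) _
        (Finset.filter_subset _ _) fun i hi => ?_
      rw [one_mul, (Finset.mem_filter.mp hi).2]; ring
    · refine rotSeq_injective_pair hx0 hx2 hs fun h0 => hiB ?_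
      exact Finset.mem_filter.mpr ⟨Finset.mem_range.mpr hi, h0⟩

end Mixing

section ClosedForm

variable {K : Type*} [Field K]

lemma sq_sub_four_ne_zero {x s : K} (hx0 : x ≠ 0) (hx : x ^ 2 ≠ 1) (hs : x + x⁻¹ = s) :
    s ^ 2 - 4 ≠ 0 := by
  have : s ^ 2 - 4 = ((x ^ 2 - 1) / x) ^ 2 := by
    rw [← hs]; field_simp; ring
  rw [this]
  exact pow_ne_zero 2 (div_ne_zero (sub_ne_zero.mpr hx) hx0)

lemma mul_sub_of_closed_form {x t t' y z : K} (hx0 : x ≠ 0) (hy : y = t + t')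
    (hz : z = t * x + t' * x⁻¹) : z * x - y = t * (x ^ 2 - 1) := by
  rw [hy, hz]; field_simp; ring

lemma form_of_closed_form {x s t t' y z : K} (hx0 : x ≠ 0) (hs : x + x⁻¹ = s) (hy : y = t + t')
    (hz : z = t * x + t' * x⁻¹) : s * y * z - y ^ 2 - z ^ 2 = t * t' * (s ^ 2 - 4) := by
  rw [hy, hz, ← hs]; field_simp; ring

end ClosedForm

section EndGame

variable {p : ℕ} [Fact p.Prime]

lemma exists_chi_pow_eq {α : ZMod p} {x : Fbar p} (h : orderOf x = mord α) :
    ∃ e, chi α ^ e = x := by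
  have : NeZero (orderOf (chi α)) := ⟨(mord_pos α).ne'⟩
  obtain ⟨e, -, he⟩ := (IsPrimitiveRoot.orderOf (chi α)).eq_pow_of_pow_eq_one
    (ξ := x) (by rw [← mord, ← h, pow_orderOf_eq_one])
  exact ⟨e, he⟩

lemma IsInvariant.exists_fiber_of_orderOf (hp : 2 < p) {S : ZMod p → ZMod p → ZMod p → Prop}
    (hS : IsInvariant S) {α y z : ZMod p} (h : S α y z) (hα : 4 < mord α) {x : Fbar p}
    (hx : orderOf x = mord α) :
    ∃ (t t' : Fbar p) (b : ℕ → ZMod p), t ≠ 0 ∧ t * t' ≠ 1 ∧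
      t * t' * (algebraMap (ZMod p) (Fbar p) α ^ 2 - 4) = algebraMap (ZMod p) (Fbar p) α ^ 2 ∧
      ∀ j, algebraMap (ZMod p) (Fbar p) (b j) = t * x ^ j + t' * x⁻¹ ^ j ∧ ∃ z, S (b j) α z := by
  obtain ⟨t, t', ht, -, htt, hk, hform⟩ := hS.exists_fiber hp h hα
  obtain ⟨e, rfl⟩ := exists_chi_pow_eq hx
  refine ⟨t, t', fun j => MarkoffOrbit.rotSeq α y z (e * j), ht, htt, hk, fun j =>
    ⟨?_, _, hS.swap₁₂ (hS.rotSeq h _)⟩⟩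
  rw [hform, ← inv_pow, ← pow_mul, ← pow_mul]

lemma IsInvariant.card_avoid_le (hp : 2 < p) {S : ZMod p → ZMod p → ZMod p → Prop}
    (hS : IsInvariant S) {d : ℕ} (hd : 4 < d) (A : Finset (ZMod p))
    (hA : ∀ α ∈ A, mord α = d ∧ ∃ y z, S α y z) (G : Finset (ZMod p))
    (hG : ∀ g ∈ G, ∀ y z, ¬ S g y z) : A.card * d ^ 2 * G.card ≤ 4 * p ^ 3 := by
  classical
  rcases A.eq_empty_or_nonempty with rfl | ⟨α₀, hα₀⟩
  · simp
  set φ := algebraMap (ZMod p) (Fbar p)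
  set x := chi α₀
  have hxd : orderOf x = d := (hA α₀ hα₀).1
  have hx0 : x ≠ 0 := chi_ne_zero α₀
  have hx2 : x ^ 2 ≠ 1 := chi_sq_ne_one (by rw [(hA α₀ hα₀).1]; omega)
  have hs : x + x⁻¹ = φ α₀ := chi_add_inv α₀
  have hfib : ∀ α, α ∈ A → ∃ (t t' : Fbar p) (b : ℕ → ZMod p), t ≠ 0 ∧ t * t' ≠ 1 ∧
      t * t' * (φ α ^ 2 - 4) = φ α ^ 2 ∧
      ∀ j, φ (b j) = t * x ^ j + t' * x⁻¹ ^ j ∧ ∃ z, S (b j) α z := fun α hα => by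
    obtain ⟨h1, y, z, h2⟩ := hA α hα
    exact hS.exists_fiber_of_orderOf hp h2 (by omega) (hxd.trans h1.symm)
  choose! t t' b ht htt hk hb using hfib
  have hsucc : ∀ α ∈ A, ∀ i, φ (b α (i + 1)) = (t α * x ^ i) * x + (t' α * x⁻¹ ^ i) * x⁻¹ :=
    fun α hα i => by rw [(hb α hα _).1, pow_succ, pow_succ]; ring
  let f : ZMod p × ℕ → ZMod p × ZMod p := fun a => (b a.1 a.2, b a.1 (a.2 + 1))
  let D := A ×ˢ Finset.range d
  have hmix : (D.image f).card * d * G.card ≤ 2 * p ^ 3 := by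
    rw [← hxd]
    refine rotSeq_mixing hx0 (by omega) hs _ _ fun w hw j _ hmem => ?_
    obtain ⟨⟨α, i⟩, hai, rfl⟩ := Finset.mem_image.mp hw
    have hα := (Finset.mem_product.mp hai).1
    have hrot : MarkoffOrbit.rotSeq α₀ (b α i) (b α (i + 1)) j = b α (i + j) := by
      apply φ.injective
      rw [map_rotSeq, rotSeq_eq_of_closed_form hx0 hs (hb α hα i).1 (hsucc α hα i),
        (hb α hα _).1, pow_add, pow_add]
      ring
    simp only [f] at hmem
    rw [hrot] at hmem
    obtain ⟨z, hz⟩ := (hb α hα (i + j)).2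
    exact hG _ hmem _ _ hz
  have hfibers : D.card ≤ 2 * (D.image f).card := by
    refine Finset.card_le_mul_card_image _ _ fun w _ => ?_
    have hmem : ∀ a ∈ D.filter (fun a => f a = w), a.1 ∈ A ∧ a.2 < d ∧ b a.1 a.2 = w.1 ∧
        b a.1 (a.2 + 1) = w.2 := fun a ha => by
      obtain ⟨h1, rfl⟩ := Finset.mem_filter.mp ha
      obtain ⟨h2, h3⟩ := Finset.mem_product.mp h1
      exact ⟨h2, Finset.mem_range.mp h3, rfl, rfl⟩
    have hinj : Set.InjOn Prod.fst (↑(D.filter fun a => f a = w) : Set (ZMod p × ℕ)) := by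
      rintro ⟨α, i⟩ ha ⟨α', i'⟩ ha' hαα
      obtain ⟨h1, h2, h3, h4⟩ := hmem _ ha
      obtain ⟨h1', h2', h3', h4'⟩ := hmem _ ha'
      simp only at hαα h1 h2 h3 h4 h1' h2' h3' h4'
      subst hαα
      have e := mul_sub_of_closed_form hx0 (hb α h1 i).1 (hsucc α h1 i)
      have e' := mul_sub_of_closed_form hx0 (hb α h1 i').1 (hsucc α h1 i')
      rw [h3, h4] at e
      rw [h3', h4', e] at e'
      have e2 := mul_left_cancel₀ (ht α h1) (mul_right_cancel₀ (sub_ne_zero.mpr hx2) e')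
      refine Prod.ext rfl (pow_injOn_range (x := x) ?_ ?_ e2)
      · simpa [hxd] using h2
      · simpa [hxd] using h2'
    have hval : ∀ a ∈ D.filter (fun a => f a = w), ∀ a' ∈ D.filter (fun a => f a = w),
        a.1 ^ 2 = a'.1 ^ 2 := by
      rintro ⟨α, i⟩ ha ⟨α', i'⟩ ha'
      obtain ⟨h1, -, h3, h4⟩ := hmem _ ha
      obtain ⟨h1', -, h3', h4'⟩ := hmem _ ha'
      simp only at h1 h3 h4 h1' h3' h4' ⊢
      have hxi : ∀ i, x ^ i * x⁻¹ ^ i = 1 := fun i => by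
        rw [← mul_pow, mul_inv_cancel₀ hx0, one_pow]
      have e := form_of_closed_form hx0 hs (hb α h1 i).1 (hsucc α h1 i)
      have e' := form_of_closed_form hx0 hs (hb α' h1' i').1 (hsucc α' h1' i')
      rw [h3, h4] at e
      rw [h3', h4', e] at e'
      have e2 := mul_right_cancel₀ (sq_sub_four_ne_zero hx0 hx2 hs) e'
      have e3 : t α * t' α = t α' * t' α' := by
        linear_combination e2 - t α * t' α * hxi i + t α' * t' α' * hxi i'
      have e4 := hk α h1
      have e5 := hk α' h1'
      rw [← e3] at e5
      apply φ.injective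
      rw [map_pow, map_pow]
      refine mul_left_cancel₀ (sub_ne_zero.mpr (htt α h1)) ?_
      linear_combination e4 - e5
    rw [← Finset.card_image_of_injOn hinj]
    rcases (D.filter fun a => f a = w).eq_empty_or_nonempty with h0 | ⟨a₀, ha₀⟩
    · simp [h0]
    · have hsub : (D.filter fun a => f a = w).image Prod.fst ⊆ {a₀.1, -a₀.1} := fun v hv => by
        obtain ⟨a, ha, rfl⟩ := Finset.mem_image.mp hv
        rw [Finset.mem_insert, Finset.mem_singleton]
        exact sq_eq_sq_iff_eq_or_eq_neg.mp (hval a ha a₀ ha₀)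
      exact (Finset.card_le_card hsub).trans Finset.card_le_two
  have hD : D.card = A.card * d := by simp [D]
  calc A.card * d ^ 2 * G.card = D.card * (d * G.card) := by rw [hD]; ring
    _ ≤ 2 * (D.image f).card * (d * G.card) := Nat.mul_le_mul_right _ hfibers
    _ = 2 * ((D.image f).card * d * G.card) := by ring
    _ ≤ 2 * (2 * p ^ 3) := Nat.mul_le_mul_left _ hmix
    _ = 4 * p ^ 3 := by ring

/-- Two invariant sets meeting a common fiber over an element of order `p - 1` share the fiber. -/
lemma IsInvariant.mem_of_mord_eq (hp : 5 < p) {S S' : ZMod p → ZMod p → ZMod p → Prop}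
    (hS : IsInvariant S) (hS' : IsInvariant S') {g y z y' z' : ZMod p} (hg : mord g = p - 1)
    (h : S g y z) (h' : S' g y' z') : S' g y z := by
  set φ := algebraMap (ZMod p) (Fbar p)
  have hx0 := chi_ne_zero g
  have hx2 := chi_sq_ne_one (s := g) (by omega)
  have hs := chi_add_inv g
  have hxp : chi g ^ p = chi g := by
    have h1 := chi_pow_mord g
    rw [hg] at h1
    calc chi g ^ p = chi g ^ (p - 1 + 1) := by rw [Nat.sub_add_cancel (by omega)]
      _ = chi g := by rw [pow_succ, h1, one_mul]
  have key : ∀ {t t' : Fbar p} {y z : ZMod p}, t ≠ 0 →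
      (∀ j, φ (MarkoffOrbit.rotSeq g y z j) = t * chi g ^ j + t' * (chi g)⁻¹ ^ j) →
      t ^ (p - 1) = 1 := by
    intro t t' y z ht hform
    have e := mul_sub_of_closed_form (t := t) (t' := t') hx0 (by simpa using hform 0)
      (by simpa using hform 1)
    have e' := congrArg (fun r => r ^ p) e
    simp only [sub_pow_char, mul_pow, ← map_pow, ZMod.pow_card] at e'
    rw [← pow_mul, mul_comm 2 p, pow_mul, hxp, one_pow] at e'
    have e2 := mul_right_cancel₀ (sub_ne_zero.mpr hx2) (e'.symm.trans e)
    refine mul_right_cancel₀ ht ?_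
    rw [← pow_succ, Nat.sub_add_cancel (by omega), e2, one_mul]
  obtain ⟨t, t', ht, ht', -, hk, hform⟩ := hS.exists_fiber (by omega) h (by omega)
  obtain ⟨r, r', hr, hr', -, hk', hform'⟩ := hS'.exists_fiber (by omega) h' (by omega)
  have : NeZero (orderOf (chi g)) := ⟨(mord_pos g).ne'⟩
  obtain ⟨i, -, hi⟩ := (IsPrimitiveRoot.orderOf (chi g)).eq_pow_of_pow_eq_one (ξ := t / r)
    (by rw [← mord, hg, div_pow, key ht hform, key hr hform', div_one])
  have e1 : t = r * chi g ^ i := by rw [hi]; field_simp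
  have hprod : t * t' = r * r' := mul_right_cancel₀ (sq_sub_four_ne_zero hx0 hx2 hs)
    (hk.trans hk'.symm)
  have e2 : t' = r' * (chi g)⁻¹ ^ i := by
    refine mul_left_cancel₀ ht ?_
    have : chi g ^ i * (chi g)⁻¹ ^ i = 1 := by rw [← mul_pow, mul_inv_cancel₀ hx0, one_pow]
    rw [hprod, e1]
    linear_combination (-r * r') * this
  have hy : y = MarkoffOrbit.rotSeq g y' z' i := φ.injective (by
    rw [hform', ← e1, ← e2]; simpa using hform 0)
  have hz : z = MarkoffOrbit.rotSeq g y' z' (i + 1) := φ.injective (by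
    rw [hform', pow_succ, pow_succ, ← mul_assoc, ← mul_assoc, ← e1, ← e2]; simpa using hform 1)
  rw [hy, hz]
  exact hS'.rotSeq h' i

lemma le_card_divisors_mul_totient {n : ℕ} (hn : 0 < n) :
    n ≤ n.divisors.card * n.totient := by
  conv_lhs => rw [← Nat.sum_totient n]
  rw [← smul_eq_mul]
  refine Finset.sum_le_card_nsmul _ _ _ fun d hd => ?_
  exact Nat.le_of_dvd (Nat.totient_pos.mpr hn) (Nat.totient_dvd_of_dvd (Nat.dvd_of_mem_divisors hd))

lemma totient_le_two_mul_card [DecidablePred fun g : ZMod p => mord g = p - 1] :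
    (p - 1).totient ≤ 2 * (Finset.univ.filter fun g : ZMod p => mord g = p - 1).card := by
  classical
  set φ := algebraMap (ZMod p) (Fbar p)
  let f : (ZMod p)ˣ → ZMod p := fun u => u + (u⁻¹ : (ZMod p)ˣ)
  have hf : ∀ u : (ZMod p)ˣ, φ u + (φ u)⁻¹ = φ (f u) := fun u => by
    simp only [f]
    rw [map_add, Units.val_inv_eq_inv_val, map_inv₀]
  have hcard : (Finset.univ.filter fun u : (ZMod p)ˣ => orderOf u = p - 1).card =
      (p - 1).totient := by
    refine IsCyclic.card_orderOf_eq_totient ?_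
    rw [ZMod.card_units]
  rw [← hcard]
  calc _ ≤ 2 * ((Finset.univ.filter fun u : (ZMod p)ˣ => orderOf u = p - 1).image f).card := by
        refine Finset.card_le_mul_card_image _ _ fun v hv => ?_
        obtain ⟨u₀, -, rfl⟩ := Finset.mem_image.mp hv
        refine (Finset.card_le_card (t := {u₀, u₀⁻¹}) fun u hu => ?_).trans Finset.card_le_two
        have h1 := (Finset.mem_filter.mp hu).2
        have h2 : (u : ZMod p) + (u : ZMod p)⁻¹ = u₀ + (u₀ : ZMod p)⁻¹ := by
          simpa only [f, Units.val_inv_eq_inv_val] using h1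
        rw [Finset.mem_insert, Finset.mem_singleton]
        rcases eq_or_eq_inv_of_add_inv_eq u.ne_zero u₀.ne_zero h2 with h | h
        · exact Or.inl (Units.ext h)
        · exact Or.inr (Units.ext (by rwa [Units.val_inv_eq_inv_val]))
    _ ≤ _ := by
        gcongr
        intro v hv
        obtain ⟨u, hu, rfl⟩ := Finset.mem_image.mp hv
        refine Finset.mem_filter.mpr ⟨Finset.mem_univ _, ?_⟩
        rw [← orderOf_eq_mord ((map_ne_zero φ).mpr u.ne_zero) (hf u), ← (Finset.mem_filter.mp hu).2,
          ← orderOf_units]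
        exact orderOf_injective (φ : ZMod p →* Fbar p) φ.injective _

end EndGame

section Meet

variable {p : ℕ} [Fact p.Prime]

lemma IsInvariant.exists_large_class (hp : 2 < p) {S : ZMod p → ZMod p → ZMod p → Prop}
    (hS : IsInvariant S) {x y z : ZMod p} (h : S x y z) (hx : 4 < mord x) :
    ∃ (d : ℕ) (A : Finset (ZMod p)), (∀ α ∈ A, mord α = d ∧ ∃ y z, S α y z) ∧
      mord x ≤ 2 * (p ^ 2 - 1).divisors.card * A.card ∧ A.card ≤ d := by
  classical
  obtain ⟨t, t', ht, -, -, -, hform⟩ := hS.exists_fiber hp h hx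
  set V := (Finset.range (mord x)).image (MarkoffOrbit.rotSeq x y z)
  have hV : mord x ≤ 2 * V.card := by
    conv_lhs => rw [← Finset.card_range (mord x)]
    refine Finset.card_le_mul_card_image _ _ fun w _ => ?_
    exact card_rotSeq_eq_le_two ht hform w _ (Finset.filter_subset _ _)
      fun j hj => (Finset.mem_filter.mp hj).2
  have hdiv : ∀ α : ZMod p, mord α ∈ (p ^ 2 - 1).divisors := fun α =>
    Nat.mem_divisors.mpr ⟨mord_dvd _, sq_sub_one_pos.ne'⟩
  have hex : ∃ d ∈ (p ^ 2 - 1).divisors,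
      mord x ≤ 2 * (p ^ 2 - 1).divisors.card * (V.filter fun α => mord α = d).card := by
    by_contra! hlt
    have h1 := Finset.sum_lt_sum_of_nonempty ⟨_, hdiv x⟩ hlt
    rw [← Finset.mul_sum, ← Finset.card_eq_sum_card_fiberwise (fun α _ => hdiv α),
      Finset.sum_const, smul_eq_mul] at h1
    nlinarith
  obtain ⟨d, -, hd⟩ := hex
  refine ⟨d, V.filter fun α => mord α = d, fun α hα => ?_, hd,
    card_mord_eq_le d _ fun α hα => (Finset.mem_filter.mp hα).2⟩
  obtain ⟨h1, h2⟩ := Finset.mem_filter.mp hα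
  obtain ⟨j, -, rfl⟩ := Finset.mem_image.mp h1
  exact ⟨h2, _, _, hS.swap₁₂ (hS.rotSeq h j)⟩

lemma IsInvariant.card_avoid_le_of_mord (hp : 2 < p) {S : ZMod p → ZMod p → ZMod p → Prop}
    (hS : IsInvariant S) {k : ℕ} (hk : 18 * (p ^ 2 - 1).divisors.card < k) (hkp : k ^ 20 ≤ p)
    {x y z : ZMod p} (h : S x y z) (hm : 17 * k ^ 9 ≤ mord x) (G : Finset (ZMod p))
    (hG : ∀ g ∈ G, ∀ y z, ¬ S g y z) : G.card ≤ 4 * k ^ 6 := by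
  obtain ⟨x, y, z, h, hm, hp'⟩ := hS.exists_le_mord hp hk h hm
  have hτ : 0 < (p ^ 2 - 1).divisors.card :=
    Finset.card_pos.mpr ⟨1, Nat.one_mem_divisors.mpr sq_sub_one_pos.ne'⟩
  have hk18 : 18 ≤ k := by omega
  have hk0 : 0 < k := by omega
  have hk9 : k ≤ k ^ 9 := Nat.le_self_pow (by norm_num) k
  obtain ⟨d, A, hA, hmA, hAd⟩ := hS.exists_large_class hp h (by omega)
  have h9 : 9 * mord x ≤ k * A.card := by
    have : 18 * (p ^ 2 - 1).divisors.card * A.card ≤ k * A.card := Nat.mul_le_mul_right _ hk.le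
    linarith
  have hk2 : 9 * k ^ 2 ≤ p := by
    refine le_trans ?_ hkp
    calc 9 * k ^ 2 ≤ k ^ 18 * k ^ 2 :=
          Nat.mul_le_mul_right _ ((show 9 ≤ k by omega).trans (Nat.le_self_pow (by norm_num) k))
      _ = k ^ 20 := by ring
  have hpA : p ≤ k ^ 2 * A.card := by
    have : 9 * mord x * k ≤ k * A.card * k := Nat.mul_le_mul_right _ h9
    nlinarith
  have hpd : p ≤ k ^ 2 * d := hpA.trans (Nat.mul_le_mul_left _ hAd)
  have hd : 4 < d := by
    by_contra! hd4
    have : k ^ 2 * d ≤ k ^ 2 * 4 := Nat.mul_le_mul_left _ hd4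
    have : 0 < k ^ 2 := by positivity
    omega
  have hav := hS.card_avoid_le hp hd A hA G hG
  have hp0 : 0 < p ^ 3 := by positivity
  refine Nat.le_of_mul_le_mul_left ?_ hp0
  calc p ^ 3 * G.card = p * p ^ 2 * G.card := by ring
    _ ≤ (k ^ 2 * A.card) * (k ^ 2 * d) ^ 2 * G.card := by gcongr
    _ = k ^ 6 * (A.card * d ^ 2 * G.card) := by ring
    _ ≤ k ^ 6 * (4 * p ^ 3) := Nat.mul_le_mul_left _ hav
    _ = p ^ 3 * (4 * k ^ 6) := by ring

/-- Two invariant sets containing points with a coordinate of not too small order meet. -/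
theorem IsInvariant.exists_common {S S' : ZMod p → ZMod p → ZMod p → Prop}
    (hS : IsInvariant S) (hS' : IsInvariant S') {k : ℕ}
    (hk : 18 * (p ^ 2 - 1).divisors.card < k) (hkp : k ^ 20 ≤ p)
    {x y z x' y' z' : ZMod p} (h : S x y z) (hm : 17 * k ^ 9 ≤ mord x)
    (h' : S' x' y' z') (hm' : 17 * k ^ 9 ≤ mord x') : ∃ a b c, S a b c ∧ S' a b c := by
  classical
  have hτ : 0 < (p ^ 2 - 1).divisors.card :=
    Finset.card_pos.mpr ⟨1, Nat.one_mem_divisors.mpr sq_sub_one_pos.ne'⟩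
  have hk18 : 18 ≤ k := by omega
  have hk20 : k ≤ k ^ 20 := Nat.le_self_pow (by norm_num) k
  have hp : 5 < p := by omega
  set G := Finset.univ.filter fun g : ZMod p => mord g = p - 1
  have hGcard : 9 * (p - 1) ≤ k * G.card := by
    have h1 := le_card_divisors_mul_totient (n := p - 1) (by omega)
    have h2 : (p - 1).totient ≤ 2 * G.card := totient_le_two_mul_card
    have h3 : (p - 1).divisors.card ≤ (p ^ 2 - 1).divisors.card := by
      refine Finset.card_le_card (Nat.divisors_subset_of_dvd sq_sub_one_pos.ne' ?_)
      exact Dvd.intro_left (p + 1) (by simpa using (Nat.sq_sub_sq p 1).symm)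
    calc 9 * (p - 1) ≤ 9 * ((p ^ 2 - 1).divisors.card * (2 * G.card)) := by
          gcongr
          exact h1.trans (Nat.mul_le_mul h3 h2)
      _ = 18 * (p ^ 2 - 1).divisors.card * G.card := by ring
      _ ≤ k * G.card := Nat.mul_le_mul_right _ hk.le
  have hG1 := hS.card_avoid_le_of_mord (by omega) hk hkp h hm
    (G.filter fun g => ¬ ∃ y z, S g y z) (fun g hg y z hgyz =>
      (Finset.mem_filter.mp hg).2 ⟨y, z, hgyz⟩)
  have hG2 := hS'.card_avoid_le_of_mord (by omega) hk hkp h' hm'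
    (G.filter fun g => ¬ ∃ y z, S' g y z) (fun g hg y z hgyz =>
      (Finset.mem_filter.mp hg).2 ⟨y, z, hgyz⟩)
  by_contra! hcon
  have hsub : G ⊆ (G.filter fun g => ¬ ∃ y z, S g y z) ∪
      (G.filter fun g => ¬ ∃ y z, S' g y z) := fun g hg => by
    by_cases h1 : ∃ y z, S g y z
    · refine Finset.mem_union_right _ (Finset.mem_filter.mpr ⟨hg, fun ⟨y', z', h2⟩ => ?_⟩)
      obtain ⟨y, z, h1⟩ := h1
      exact hcon _ _ _ h1 (hS.mem_of_mord_eq hp hS' (Finset.mem_filter.mp hg).2 h1 h2)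
    · exact Finset.mem_union_left _ (Finset.mem_filter.mpr ⟨hg, h1⟩)
  have hle : G.card ≤ 8 * k ^ 6 := by
    have := (Finset.card_le_card hsub).trans (Finset.card_union_le _ _)
    omega
  have h7 : 9 * (p - 1) ≤ 8 * k ^ 7 := by
    calc 9 * (p - 1) ≤ k * (8 * k ^ 6) := hGcard.trans (Nat.mul_le_mul_left _ hle)
      _ = 8 * k ^ 7 := by ring
  have h8 : 8 * k ^ 7 ≤ k ^ 20 := by
    calc 8 * k ^ 7 ≤ k ^ 13 * k ^ 7 :=
          Nat.mul_le_mul_right _ ((show 8 ≤ k by omega).trans (Nat.le_self_pow (by norm_num) k))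
      _ = k ^ 20 := by ring
  omega

lemma card_mord_lt_le (M : ℕ) (T : Finset (ZMod p)) (hT : ∀ s ∈ T, mord s < M) :
    T.card ≤ M ^ 2 := by
  classical
  calc T.card = ∑ n ∈ Finset.range M, (T.filter fun s => mord s = n).card :=
        Finset.card_eq_sum_card_fiberwise fun s hs => Finset.mem_coe.mpr
          (Finset.mem_range.mpr (hT s hs))
    _ ≤ ∑ n ∈ Finset.range M, M := Finset.sum_le_sum fun n hn =>
        (card_mord_eq_le n _ fun s hs => (Finset.mem_filter.mp hs).2).trans
          (Finset.mem_range.mp hn).le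
    _ = M ^ 2 := by simp [sq]

end Meet

section Divisors

lemma succ_pow_le (r v : ℕ) (hr : 0 < r) : (v + 1) ^ r ≤ r ^ r * 2 ^ v := by
  have h1 : v + 1 ≤ r * 2 ^ (v / r) := by
    have h2 : v < r * (v / r + 1) := Nat.lt_mul_div_succ v hr
    have h3 : v / r + 1 ≤ 2 ^ (v / r) := Nat.lt_two_pow_self
    exact h2.trans_le (Nat.mul_le_mul_left _ h3)
  calc (v + 1) ^ r ≤ (r * 2 ^ (v / r)) ^ r := Nat.pow_le_pow_left h1 r
    _ = r ^ r * 2 ^ (v / r * r) := by rw [mul_pow, ← pow_mul]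
    _ ≤ r ^ r * 2 ^ v := by
      gcongr
      · norm_num
      · exact Nat.div_mul_le_self v r

/-- The divisor bound: the number of divisors of `n` is `O(n ^ (1 / r))` for every `r`. -/
theorem card_divisors_pow_le (r : ℕ) (hr : 0 < r) {n : ℕ} (hn : n ≠ 0) :
    n.divisors.card ^ r ≤ (r ^ r) ^ 2 ^ r * n := by
  have hr1 : 1 ≤ r ^ r := Nat.one_le_pow _ _ hr
  rw [Nat.card_divisors hn, ← Finset.prod_pow]
  conv_rhs => rw [← Nat.prod_factorization_pow_eq_self hn]
  rw [Finsupp.prod, Nat.support_factorization]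
  calc ∏ q ∈ n.primeFactors, (n.factorization q + 1) ^ r
      ≤ ∏ q ∈ n.primeFactors, ((if q < 2 ^ r then r ^ r else 1) * q ^ n.factorization q) := by
        refine Finset.prod_le_prod' fun q hq => ?_
        have hq2 : 2 ≤ q := (Nat.prime_of_mem_primeFactors hq).two_le
        split_ifs with hlt
        · exact (succ_pow_le r _ hr).trans (by gcongr)
        · rw [one_mul]
          calc (n.factorization q + 1) ^ r ≤ (2 ^ n.factorization q) ^ r :=
                Nat.pow_le_pow_left Nat.lt_two_pow_self r
            _ = (2 ^ r) ^ n.factorization q := by rw [← pow_mul, ← pow_mul, mul_comm]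
            _ ≤ q ^ n.factorization q := Nat.pow_le_pow_left (not_lt.mp hlt) _
    _ = (r ^ r) ^ (n.primeFactors.filter (· < 2 ^ r)).card *
          ∏ q ∈ n.primeFactors, q ^ n.factorization q := by
        rw [Finset.prod_mul_distrib, ← Finset.prod_filter, Finset.prod_const]
    _ ≤ (r ^ r) ^ 2 ^ r * ∏ q ∈ n.primeFactors, q ^ n.factorization q := by
        gcongr
        calc (n.primeFactors.filter (· < 2 ^ r)).card ≤ (Finset.range (2 ^ r)).card :=
              Finset.card_le_card fun q hq => Finset.mem_range.mpr (Finset.mem_filter.mp hq).2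
          _ = 2 ^ r := Finset.card_range _

end Divisors

section Orbit

variable {p : ℕ}

lemma MarkoffStep.mem_iff {a b : ZMod p × ZMod p × ZMod p} (h : MarkoffStep p a b) :
    a ∈ MarkoffX p ↔ b ∈ MarkoffX p := by
  obtain ⟨x, y, z⟩ := a
  simp only [MarkoffX, Set.mem_ofPred_eq]
  rcases h with rfl | rfl | rfl | rfl | rfl | rfl <;>
    constructor <;> intro h <;> linear_combination h

lemma mem_of_mem_markoffOrbit {P Q : ZMod p × ZMod p × ZMod p} (h : Q ∈ markoffOrbit p P)
    (hP : P ∈ MarkoffX p) : Q ∈ MarkoffX p := by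
  have key : ∀ {P Q}, Relation.EqvGen (MarkoffStep p) P Q →
      (P ∈ MarkoffX p ↔ Q ∈ MarkoffX p) := by
    intro P Q h
    induction h with
    | rel _ _ h => exact MarkoffStep.mem_iff h
    | refl => exact Iff.rfl
    | symm _ _ _ ih => exact ih.symm
    | trans _ _ _ _ _ ih₁ ih₂ => exact ih₁.trans ih₂
  exact (key h).mp hP

lemma mem_markoffOrbit_of_step {P Q R : ZMod p × ZMod p × ZMod p} (h : Q ∈ markoffOrbit p P)
    (hs : MarkoffStep p Q R) : R ∈ markoffOrbit p P :=
  Relation.EqvGen.trans _ _ _ h (Relation.EqvGen.rel _ _ hs)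

/-- The orbit of `P`, in the coordinates in which the surface is `x² + y² + z² = x y z`. -/
def scaledOrbit (P : ZMod p × ZMod p × ZMod p) (x y z : ZMod p) : Prop :=
  ∃ a b c, x = 3 * a ∧ y = 3 * b ∧ z = 3 * c ∧ (a, b, c) ∈ markoffOrbit p P

lemma isInvariant_scaledOrbit {P : ZMod p × ZMod p × ZMod p} (hP : P ∈ MarkoffX p) :
    IsInvariant (scaledOrbit P) where
  eqn := by
    rintro _ _ _ ⟨a, b, c, rfl, rfl, rfl, h⟩
    have : a ^ 2 + b ^ 2 + c ^ 2 = 3 * a * b * c := mem_of_mem_markoffOrbit h hP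
    linear_combination 9 * this
  swap₁₂ := by
    rintro _ _ _ ⟨a, b, c, rfl, rfl, rfl, h⟩
    exact ⟨b, a, c, rfl, rfl, rfl, mem_markoffOrbit_of_step h (Or.inl rfl)⟩
  swap₂₃ := by
    rintro _ _ _ ⟨a, b, c, rfl, rfl, rfl, h⟩
    exact ⟨a, c, b, rfl, rfl, rfl, mem_markoffOrbit_of_step h (Or.inr (Or.inl rfl))⟩
  vieta := by
    rintro _ _ _ ⟨a, b, c, rfl, rfl, rfl, h⟩
    exact ⟨a, b, 3 * a * b - c, rfl, rfl, by ring,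
      mem_markoffOrbit_of_step h (Or.inr (Or.inr (Or.inr (Or.inr (Or.inr rfl)))))⟩

variable [Fact p.Prime]

lemma exists_scaledOrbit_of_large {P : ZMod p × ZMod p × ZMod p} {M : ℕ}
    (hM : M ≤ mord (3 * P.1) ∨ M ≤ mord (3 * P.2.1) ∨ M ≤ mord (3 * P.2.2)) :
    ∃ x y z, scaledOrbit P x y z ∧ M ≤ mord x := by
  obtain ⟨a, b, c⟩ := P
  have h : (a, b, c) ∈ markoffOrbit p (a, b, c) := Relation.EqvGen.refl _
  rcases hM with hM | hM | hM
  · exact ⟨3 * a, 3 * b, 3 * c, ⟨a, b, c, rfl, rfl, rfl, h⟩, hM⟩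
  · exact ⟨3 * b, 3 * a, 3 * c, ⟨b, a, c, rfl, rfl, rfl,
      mem_markoffOrbit_of_step h (Or.inl rfl)⟩, hM⟩
  · exact ⟨3 * c, 3 * b, 3 * a, ⟨c, b, a, rfl, rfl, rfl,
      mem_markoffOrbit_of_step h (Or.inr (Or.inr (Or.inl rfl)))⟩, hM⟩

lemma three_ne_zero_of_lt (hp : 3 < p) : (3 : ZMod p) ≠ 0 := by
  intro h
  have h' : ((3 : ℕ) : ZMod p) = 0 := by exact_mod_cast h
  rw [ZMod.natCast_eq_zero_iff] at h'
  exact absurd (Nat.le_of_dvd (by norm_num) h') (by omega)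

lemma mem_markoffOrbit_of_large {k : ℕ} (hk : 18 * (p ^ 2 - 1).divisors.card < k)
    (hkp : k ^ 20 ≤ p) (hp : 3 < p) {P Q : ZMod p × ZMod p × ZMod p} (hP : P ∈ MarkoffX p)
    (hQ : Q ∈ MarkoffX p)
    (hPm : 17 * k ^ 9 ≤ mord (3 * P.1) ∨ 17 * k ^ 9 ≤ mord (3 * P.2.1) ∨
      17 * k ^ 9 ≤ mord (3 * P.2.2))
    (hQm : 17 * k ^ 9 ≤ mord (3 * Q.1) ∨ 17 * k ^ 9 ≤ mord (3 * Q.2.1) ∨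
      17 * k ^ 9 ≤ mord (3 * Q.2.2)) : Q ∈ markoffOrbit p P := by
  obtain ⟨x, y, z, h, hm⟩ := exists_scaledOrbit_of_large hPm
  obtain ⟨x', y', z', h', hm'⟩ := exists_scaledOrbit_of_large hQm
  obtain ⟨_, _, _, ⟨a, b, c, rfl, rfl, rfl, h1⟩, ⟨a', b', c', e1, e2, e3, h2⟩⟩ :=
    (isInvariant_scaledOrbit hP).exists_common (isInvariant_scaledOrbit hQ) hk hkp h hm h' hm'
  have h3 := three_ne_zero_of_lt hp
  obtain rfl := mul_left_cancel₀ h3 e1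
  obtain rfl := mul_left_cancel₀ h3 e2
  obtain rfl := mul_left_cancel₀ h3 e3
  exact Relation.EqvGen.trans _ _ _ h1 (Relation.EqvGen.symm _ _ h2)

/-- There is an orbit whose complement has at most `k ^ 60` elements, as soon as `k` exceeds a
multiple of the number of divisors of `p ^ 2 - 1`. -/
theorem exists_markoffOrbit_ncard_le {k : ℕ} (hk : 18 * (p ^ 2 - 1).divisors.card < k)
    (hkp : k ^ 20 ≤ p) :
    ∃ x ∈ MarkoffXstar p, (MarkoffXstar p \ markoffOrbit p x).ncard ≤ k ^ 60 := by
  classical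
  have hτ : 0 < (p ^ 2 - 1).divisors.card :=
    Finset.card_pos.mpr ⟨1, Nat.one_mem_divisors.mpr sq_sub_one_pos.ne'⟩
  have hk20 : k ≤ k ^ 20 := Nat.le_self_pow (by norm_num) k
  have hp : 3 < p := by omega
  let large : ZMod p × ZMod p × ZMod p → Prop := fun P =>
    17 * k ^ 9 ≤ mord (3 * P.1) ∨ 17 * k ^ 9 ≤ mord (3 * P.2.1) ∨ 17 * k ^ 9 ≤ mord (3 * P.2.2)
  obtain ⟨x, hx, hxl⟩ : ∃ x ∈ MarkoffXstar p, ∀ Q ∈ MarkoffXstar p, large Q →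
      Q ∈ markoffOrbit p x := by
    by_cases hex : ∃ x ∈ MarkoffXstar p, large x
    · obtain ⟨x, hx, hl⟩ := hex
      exact ⟨x, hx, fun Q hQ hQl => mem_markoffOrbit_of_large hk hkp hp hx.1 hQ.1 hl hQl⟩
    · refine ⟨(1, 1, 1), ⟨?_, ?_⟩, fun Q hQ hQl => absurd ⟨Q, hQ, hQl⟩ hex⟩
      · simp only [MarkoffX, Set.mem_ofPred_eq]; norm_num
      · simp
  refine ⟨x, hx, ?_⟩
  let T := Finset.univ.filter fun s : ZMod p => mord (3 * s) < 17 * k ^ 9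
  have hT : T.card ≤ k ^ 20 := by
    have h3 : Function.Injective fun s : ZMod p => 3 * s :=
      mul_right_injective₀ (three_ne_zero_of_lt hp)
    have h1 := card_mord_lt_le (17 * k ^ 9) (T.image fun s => 3 * s) fun s hs => by
      obtain ⟨r, hr, rfl⟩ := Finset.mem_image.mp hs
      exact (Finset.mem_filter.mp hr).2
    rw [Finset.card_image_of_injective _ h3] at h1
    calc T.card ≤ (17 * k ^ 9) ^ 2 := h1
      _ ≤ (k * k ^ 9) ^ 2 := by gcongr; omega
      _ = k ^ 20 := by ring
  have hsub : MarkoffXstar p \ markoffOrbit p x ⊆ (↑(T ×ˢ T ×ˢ T) : Set _) := fun Q hQ => by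
    have hQl : ¬ large Q := fun hl => hQ.2 (hxl Q hQ.1 hl)
    simp only [large, not_or, not_le] at hQl
    simpa [T] using hQl
  calc _ ≤ (T ×ˢ T ×ˢ T).card := by
        rw [← Set.ncard_coe_finset]
        exact Set.ncard_le_ncard hsub (Finset.finite_toSet _)
    _ = T.card ^ 3 := by rw [Finset.card_product, Finset.card_product]; ring
    _ ≤ (k ^ 20) ^ 3 := by gcongr
    _ = k ^ 60 := by ring

end Orbit

end MarkoffOrbit

theorem markoff_large_orbit :
    ∀ ε : ℝ, 0 < ε → ∃ P₀ : ℕ, ∀ p : ℕ, p.Prime → P₀ ≤ p →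
      ∃ x ∈ MarkoffXstar p,
        ((MarkoffXstar p \ markoffOrbit p x).ncard : ℝ) ≤ (p : ℝ) ^ ε := by
  intro ε hε
  set δ : ℝ := min ε 1 / 60 with hδ
  have hδ0 : 0 < δ := by positivity
  obtain ⟨r, hr⟩ := exists_nat_ge (3 / δ)
  have hrδ : 3 ≤ δ * r := by
    rw [div_le_iff₀ hδ0] at hr
    linarith
  have hr0 : 0 < r := by
    rcases Nat.eq_zero_or_pos r with rfl | h
    · norm_num at hrδ
    · exact h
  set C : ℕ := (r ^ r) ^ 2 ^ r
  refine ⟨19 ^ r * C + 1, fun p hp hpC => ?_⟩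
  have : Fact p.Prime := ⟨hp⟩
  have hp1 : (1 : ℝ) ≤ p := by exact_mod_cast hp.one_lt.le
  have hp0 : (0 : ℝ) ≤ p := by linarith
  set k : ℕ := ⌊(p : ℝ) ^ δ⌋₊
  have hpow : ∀ e : ℕ, (k : ℝ) ^ e ≤ (p : ℝ) ^ (δ * e) := fun e => by
    rw [Real.rpow_mul_natCast hp0]
    gcongr
    exact Nat.floor_le (by positivity)
  have hkp : k ^ 20 ≤ p := by
    have h1 : (k : ℝ) ^ 20 ≤ (p : ℝ) ^ (1 : ℝ) := (hpow 20).trans (by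
      refine Real.rpow_le_rpow_of_exponent_le hp1 ?_
      have := min_le_right ε 1
      push_cast
      linarith)
    rw [Real.rpow_one] at h1
    exact_mod_cast h1
  have hk : 18 * (p ^ 2 - 1).divisors.card < k := by
    by_contra! hle
    set τ := (p ^ 2 - 1).divisors.card
    have hpos : 0 < p ^ 2 - 1 := MarkoffOrbit.sq_sub_one_pos
    have hτ : 0 < τ := Finset.card_pos.mpr ⟨1, Nat.one_mem_divisors.mpr hpos.ne'⟩
    have h1 : (p : ℝ) ^ δ ≤ 19 * τ := by
      refine (Nat.lt_floor_add_one _).le.trans ?_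
      have : k + 1 ≤ 19 * τ := by omega
      exact_mod_cast this
    have h2 : (p : ℝ) ^ 3 ≤ (19 * τ) ^ r := by
      calc (p : ℝ) ^ 3 = (p : ℝ) ^ (3 : ℝ) := by norm_cast
        _ ≤ (p : ℝ) ^ (δ * r) := Real.rpow_le_rpow_of_exponent_le hp1 hrδ
        _ = ((p : ℝ) ^ δ) ^ r := Real.rpow_mul_natCast hp0 _ _
        _ ≤ _ := by gcongr
    have h3 : p ^ 3 ≤ (19 * τ) ^ r := by exact_mod_cast h2
    have h4 : p ^ 2 * p ≤ p ^ 2 * (19 ^ r * C) := by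
      calc p ^ 2 * p = p ^ 3 := by ring
        _ ≤ 19 ^ r * τ ^ r := by rw [← mul_pow]; exact h3
        _ ≤ 19 ^ r * (C * (p ^ 2 - 1)) :=
            Nat.mul_le_mul_left _ (MarkoffOrbit.card_divisors_pow_le r hr0 hpos.ne')
        _ ≤ 19 ^ r * (C * p ^ 2) := by gcongr; exact Nat.sub_le _ _
        _ = p ^ 2 * (19 ^ r * C) := by ring
    have h5 := Nat.le_of_mul_le_mul_left h4 (pow_pos hp.pos 2)
    omega
  obtain ⟨x, hx, hcard⟩ := MarkoffOrbit.exists_markoffOrbit_ncard_le hk hkp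
  refine ⟨x, hx, ?_⟩
  calc ((MarkoffXstar p \ markoffOrbit p x).ncard : ℝ) ≤ (k : ℝ) ^ 60 := by exact_mod_cast hcard
    _ ≤ (p : ℝ) ^ (δ * (60 : ℕ)) := hpow 60
    _ ≤ (p : ℝ) ^ ε := by
      refine Real.rpow_le_rpow_of_exponent_le hp1 ?_
      have := min_le_left ε 1
      push_cast
      linarith
end

section
/- There exists a constant c > 0 such that for every prime p ≥ 3 and every point x ∈ X*(p), the Γ-orbit of x in X*(p) has cardinality at least c·(log p)^{1/3}. -/
open Polynomial

/-- In an algebraically closed field, the resultant of the `M`-th cyclotomic polynomial with an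
integer polynomial `P` is the product of the values of `P` at the roots of the former. -/
theorem intCast_resultant_cyclotomic (K : Type*) [Field K] [IsAlgClosed K] (M : ℕ) (P : ℤ[X]) :
    ((resultant (cyclotomic M ℤ) P : ℤ) : K) =
      ((cyclotomic M K).roots.map (P.map (Int.castRingHom K)).eval).prod := by
  have h1 := resultant_map_map (cyclotomic M ℤ) P (cyclotomic M ℤ).natDegree P.natDegree
    (Int.castRingHom K)
  rw [map_cyclotomic, natDegree_cyclotomic, ← natDegree_cyclotomic M K,
    resultant_eq_prod_eval _ _ _ natDegree_map_le (IsAlgClosed.splits _),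
    (cyclotomic.monic M K).leadingCoeff, one_pow, one_mul] at h1
  rw [h1, natDegree_cyclotomic, natDegree_cyclotomic]
  rfl

/-- An integer polynomial with a zero of multiplicative order `M` in characteristic `p`, whose
values at the complex primitive `M`-th roots of unity are nonzero and bounded by `B`, forces
`p ≤ B ^ M`. -/
theorem prime_le_pow_of_eval_primitiveRoot_eq_zero {p : ℕ} {k : Type*} [Field k]
    [IsAlgClosed k] [CharP k p] {M : ℕ} (hM : 0 < M) {ω : k} (hω : IsPrimitiveRoot ω M)
    (P : ℤ[X]) (hP : eval ω (P.map (Int.castRingHom k)) = 0) {B : ℕ} (hB : 1 ≤ B)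
    (hne : ∀ z : ℂ, IsPrimitiveRoot z M → eval z (P.map (Int.castRingHom ℂ)) ≠ 0)
    (hle : ∀ z : ℂ, IsPrimitiveRoot z M → ‖eval z (P.map (Int.castRingHom ℂ))‖ ≤ B) :
    p ≤ B ^ M := by
  have hroot : ∀ z ∈ (cyclotomic M ℂ).roots, IsPrimitiveRoot z M := by
    intro z hz
    have : NeZero (M : ℂ) := ⟨by exact_mod_cast hM.ne'⟩
    exact isRoot_cyclotomic_iff.mp (isRoot_of_mem_roots hz)
  set R : ℤ := resultant (cyclotomic M ℤ) P
  have hpR : (p : ℤ) ∣ R := by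
    rw [← CharP.intCast_eq_zero_iff k p, intCast_resultant_cyclotomic k,
      Multiset.prod_eq_zero_iff, Multiset.mem_map]
    exact ⟨ω, (mem_roots (cyclotomic_ne_zero M k)).mpr (hω.isRoot_cyclotomic hM), hP⟩
  have hR0 : R ≠ 0 := by
    have : (R : ℂ) ≠ 0 := by
      rw [intCast_resultant_cyclotomic ℂ, Ne, Multiset.prod_eq_zero_iff, Multiset.mem_map]
      rintro ⟨z, hz, h⟩
      exact hne z (hroot z hz) h
    exact_mod_cast this
  have hnorm : ∀ s : Multiset ℂ, (∀ z ∈ s, IsPrimitiveRoot z M) →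
      ‖(s.map (P.map (Int.castRingHom ℂ)).eval).prod‖ ≤ (B : ℝ) ^ s.card := by
    intro s
    induction s using Multiset.induction with
    | empty => simp
    | cons z s ih =>
      intro hs
      rw [Multiset.map_cons, Multiset.prod_cons, norm_mul, Multiset.card_cons, pow_succ']
      exact mul_le_mul (hle z (hs z (Multiset.mem_cons_self z s)))
        (ih fun w hw ↦ hs w (Multiset.mem_cons_of_mem hw)) (norm_nonneg _) (Nat.cast_nonneg _)
  have hcard : (cyclotomic M ℂ).roots.card ≤ M :=
    (card_roots' _).trans (by rw [natDegree_cyclotomic]; exact Nat.totient_le M)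
  have hRle : R.natAbs ≤ B ^ M := by
    have h := hnorm _ hroot
    rw [← intCast_resultant_cyclotomic ℂ, Complex.norm_intCast] at h
    have h2 : |(R : ℝ)| ≤ (B : ℝ) ^ M :=
      h.trans (pow_le_pow_right₀ (by exact_mod_cast hB) hcard)
    rw [← Int.cast_abs, Int.abs_eq_natAbs] at h2
    exact_mod_cast h2
  exact (Nat.le_of_dvd (Int.natAbs_pos.mpr hR0) (Int.natCast_dvd.mp hpR)).trans hRle

/-- The real Markoff equation `x² + y² + z² = xyz` has only the zero solution in `[-2, 2]³`. -/
theorem eq_zero_of_markoff_of_abs_le_two {x y z : ℝ} (hx : |x| ≤ 2)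
    (h : x ^ 2 + y ^ 2 + z ^ 2 = x * y * z) (hy : |y| ≤ 2) : x = 0 ∧ y = 0 ∧ z = 0 := by
  have hx2 : x ^ 2 ≤ 4 := by nlinarith [sq_abs x, abs_nonneg x]
  have hy2 : y ^ 2 ≤ 4 := by nlinarith [sq_abs y, abs_nonneg y]
  have hyz : 2 * |y * z| ≤ y ^ 2 + z ^ 2 := by
    rw [abs_mul]
    nlinarith [sq_nonneg (|y| - |z|), sq_abs y, sq_abs z]
  have hxyz : x * y * z ≤ 2 * |y * z| := by
    calc x * y * z ≤ |x * (y * z)| := by rw [mul_assoc]; exact le_abs_self _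
      _ = |x| * |y * z| := abs_mul _ _
      _ ≤ 2 * |y * z| := mul_le_mul_of_nonneg_right hx (abs_nonneg _)
  have hx0 : x = 0 := by
    have : x ^ 2 = 0 := le_antisymm (by linarith) (sq_nonneg x)
    exact pow_eq_zero_iff (two_ne_zero) |>.mp this
  subst hx0
  refine ⟨rfl, ?_, ?_⟩ <;> nlinarith [sq_nonneg y, sq_nonneg z]

/-- The sum of a complex number of norm one and its inverse is a real number in `[-2, 2]`. -/
theorem exists_real_eq_add_of_mul_eq_one {u v : ℂ} (hu : ‖u‖ = 1) (huv : u * v = 1) :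
    ∃ t : ℝ, |t| ≤ 2 ∧ u + v = t := by
  refine ⟨2 * u.re, ?_, ?_⟩
  · rw [abs_mul, abs_two]
    linarith [Complex.abs_re_le_norm u]
  · have : v = (starRingEnd ℂ) u := by
      rw [← Complex.inv_eq_conj hu]
      exact (eq_inv_of_mul_eq_one_right huv)
    rw [this, Complex.add_conj]

/-- For primitive roots of unity of equal order, the vanishing of `z ^ a + z ^ b`, where
`z ^ a * z ^ b = 1`, transfers from one field to another. -/
theorem IsPrimitiveRoot.pow_add_pow_eq_zero_transfer {K L : Type*} [Field K] [Field L] [CharZero K]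
    {M a b : ℕ} {z : K} {ω : L} (hz : IsPrimitiveRoot z M) (hω : IsPrimitiveRoot ω M)
    (hab : M ∣ a + b) (h : z ^ a + z ^ b = 0) : ω ^ a + ω ^ b = 0 := by
  have hz1 : z ^ (a + b) = 1 := (hz.pow_eq_one_iff_dvd _).mpr hab
  have hω1 : ω ^ (a + b) = 1 := (hω.pow_eq_one_iff_dvd _).mpr hab
  rw [pow_add] at hz1 hω1
  have hz2 : z ^ (a * 2) = -1 := by
    rw [pow_mul]
    linear_combination z ^ a * h - hz1
  have hz4 : z ^ (a * 4) = 1 := by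
    rw [show a * 4 = a * 2 * 2 by ring, pow_mul, hz2]; norm_num
  have hω4 : ω ^ (a * 4) = 1 :=
    (hω.pow_eq_one_iff_dvd _).mpr ((hz.pow_eq_one_iff_dvd _).mp hz4)
  have hω2 : ω ^ (a * 2) ≠ 1 := by
    intro h1
    have h3 := (hz.pow_eq_one_iff_dvd _).mpr ((hω.pow_eq_one_iff_dvd _).mp h1)
    rw [hz2] at h3
    norm_num at h3
  have hω2' : ω ^ (a * 2) = -1 := by
    rw [show a * 4 = a * 2 * 2 by ring, pow_mul, sq_eq_one_iff] at hω4
    exact hω4.resolve_left hω2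
  rw [pow_mul] at hω2'
  have hne : ω ^ a ≠ 0 := left_ne_zero_of_mul_eq_one hω1
  apply (mul_eq_zero_iff_left hne).mp
  linear_combination hω2' + hω1

/-- A nonzero solution of `x² + y² + z² = xyz` in characteristic `p` whose coordinates are sums of
a root of unity and its inverse forces `p` to be bounded in terms of the common exponent. -/
theorem prime_le_of_markoff_rootsOfUnity {p : ℕ} {k : Type*} [Field k] [IsAlgClosed k]
    [CharP k p] {N : ℕ} (hN : 0 < N) {u v w : k} (hu : u ^ N = 1) (hv : v ^ N = 1)
    (hw : w ^ N = 1)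
    (h : (u + u⁻¹) ^ 2 + (v + v⁻¹) ^ 2 + (w + w⁻¹) ^ 2 = (u + u⁻¹) * (v + v⁻¹) * (w + w⁻¹))
    (h0 : ¬ (u + u⁻¹ = 0 ∧ v + v⁻¹ = 0 ∧ w + w⁻¹ = 0)) : p ≤ 20 ^ N := by
  have : NeZero N := ⟨hN.ne'⟩
  obtain ⟨g, hg⟩ := IsCyclic.exists_monoid_generator (α := rootsOfUnity N k)
  have hgN : ((g : kˣ) : k) ^ N = 1 := by
    have := (mem_rootsOfUnity' N (g : kˣ)).mp g.2
    exact this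
  set ω : k := ((g : kˣ) : k)
  set M := orderOf ω
  have hMN : M ∣ N := orderOf_dvd_of_pow_eq_one hgN
  have hM : 0 < M := Nat.pos_of_dvd_of_pos hMN hN
  have hω : IsPrimitiveRoot ω M := IsPrimitiveRoot.orderOf ω
  have hexp : ∀ t : k, t ^ N = 1 → ∃ a b : ℕ, M ∣ a + b ∧ t + t⁻¹ = ω ^ a + ω ^ b := by
    intro t ht
    obtain ⟨a, ha⟩ := hg (rootsOfUnity.mkOfPowEq t ht)
    have hta : ω ^ a = t := by
      have := congrArg (fun s : rootsOfUnity N k ↦ ((s : kˣ) : k)) ha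
      simpa using this
    have hd : M ∣ a + a * (M - 1) := by
      refine ⟨a, ?_⟩
      obtain ⟨m, hm⟩ : ∃ m, M = m + 1 := ⟨M - 1, by omega⟩
      rw [hm, Nat.add_sub_cancel]; ring
    refine ⟨a, a * (M - 1), hd, ?_⟩
    have h1 := (hω.pow_eq_one_iff_dvd _).mpr hd
    rw [pow_add, hta] at h1
    rw [hta, ← eq_inv_of_mul_eq_one_right h1]
  obtain ⟨a₁, b₁, hd₁, e₁⟩ := hexp u hu
  obtain ⟨a₂, b₂, hd₂, e₂⟩ := hexp v hv
  obtain ⟨a₃, b₃, hd₃, e₃⟩ := hexp w hw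
  rw [e₁, e₂, e₃] at h h0
  have hreal : ∀ z : ℂ, IsPrimitiveRoot z M → ∀ a b : ℕ, M ∣ a + b →
      ∃ t : ℝ, |t| ≤ 2 ∧ z ^ a + z ^ b = t := by
    intro z hz a b hab
    refine exists_real_eq_add_of_mul_eq_one ?_ ?_
    · rw [norm_pow, hz.norm'_eq_one hM.ne', one_pow]
    · rw [← pow_add]
      exact (hz.pow_eq_one_iff_dvd _).mpr hab
  let P : ℤ[X] := (X ^ a₁ + X ^ b₁) ^ 2 + (X ^ a₂ + X ^ b₂) ^ 2 + (X ^ a₃ + X ^ b₃) ^ 2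
    - (X ^ a₁ + X ^ b₁) * (X ^ a₂ + X ^ b₂) * (X ^ a₃ + X ^ b₃)
  refine (prime_le_pow_of_eval_primitiveRoot_eq_zero (B := 20) hM hω P ?_ (by norm_num)
    ?_ ?_).trans (Nat.pow_le_pow_right (by norm_num) (Nat.le_of_dvd hN hMN))
  · simp only [P, Polynomial.map_sub, Polynomial.map_add, Polynomial.map_mul, Polynomial.map_pow,
      map_X, eval_sub, eval_add, eval_mul, eval_pow, eval_X]
    rw [h, sub_self]
  all_goals
    intro z hz
    obtain ⟨t₁, ht₁, f₁⟩ := hreal z hz a₁ b₁ hd₁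
    obtain ⟨t₂, ht₂, f₂⟩ := hreal z hz a₂ b₂ hd₂
    obtain ⟨t₃, ht₃, f₃⟩ := hreal z hz a₃ b₃ hd₃
    simp only [P, Polynomial.map_sub, Polynomial.map_add, Polynomial.map_mul, Polynomial.map_pow,
      map_X, eval_sub, eval_add, eval_mul, eval_pow, eval_X, f₁, f₂, f₃]
  · intro hzero
    have hr : t₁ ^ 2 + t₂ ^ 2 + t₃ ^ 2 = t₁ * t₂ * t₃ := by
      exact_mod_cast sub_eq_zero.mp hzero
    obtain ⟨r₁, r₂, r₃⟩ := eq_zero_of_markoff_of_abs_le_two ht₁ hr ht₂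
    refine h0 ⟨hz.pow_add_pow_eq_zero_transfer hω hd₁ ?_,
      hz.pow_add_pow_eq_zero_transfer hω hd₂ ?_, hz.pow_add_pow_eq_zero_transfer hω hd₃ ?_⟩
    · rw [f₁, r₁, Complex.ofReal_zero]
    · rw [f₂, r₂, Complex.ofReal_zero]
    · rw [f₃, r₃, Complex.ofReal_zero]
  · have hsq : ∀ t : ℝ, |t| ≤ 2 → |t ^ 2| ≤ 4 := by
      intro t ht
      rw [abs_pow]
      nlinarith [abs_nonneg t]
    have hprod : |t₁ * t₂ * t₃| ≤ 8 := by
      rw [abs_mul, abs_mul]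
      calc |t₁| * |t₂| * |t₃| ≤ 2 * 2 * 2 := by gcongr
        _ = 8 := by norm_num
    have hbound : |t₁ ^ 2 + t₂ ^ 2 + t₃ ^ 2 - t₁ * t₂ * t₃| ≤ 20 := by
      have s₁ := abs_le.mp (hsq t₁ ht₁)
      have s₂ := abs_le.mp (hsq t₂ ht₂)
      have s₃ := abs_le.mp (hsq t₃ ht₃)
      have s₄ := abs_le.mp hprod
      exact abs_le.mpr ⟨by linarith, by linarith⟩
    rw [← Real.norm_eq_abs, ← Complex.norm_real] at hbound
    push_cast at hbound ⊢
    exact hbound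

/-- If the recurrence `(b, c) ↦ (c, y * c - b)` with `y = ζ + ζ⁻¹` takes equal values at two
distinct times below `n + 1`, then `ζ` is a root of unity of order at most `n + 1`. -/
theorem exists_pow_eq_one_of_recurrence_collision {k : Type*} [Field k] {ζ : k} (hζ : ζ ≠ 0)
    {s : ℕ → k} (hs : ∀ m, s (m + 2) = (ζ + ζ⁻¹) * s (m + 1) - s m) (h0 : s 0 ≠ 0 ∨ s 1 ≠ 0)
    {i j n : ℕ} (hij : i < j) (hj : j ≤ n) (e0 : s i = s j) (e1 : s (i + 1) = s (j + 1)) :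
    ∃ d, 0 < d ∧ d ≤ n + 1 ∧ ζ ^ d = 1 := by
  have hL : ∀ ξ : k, ξ ≠ 0 → ξ + ξ⁻¹ = ζ + ζ⁻¹ →
      ∀ m, ξ ^ m * (s (m + 1) - ξ * s m) = s 1 - ξ * s 0 := by
    intro ξ hξ he m
    induction m with
    | zero => simp
    | succ m ih =>
      rw [← ih, hs, ← he]
      field_simp
      ring
  have hcol : ∀ ξ : k, ξ ≠ 0 → ξ + ξ⁻¹ = ζ + ζ⁻¹ → s 1 ≠ ξ * s 0 → ξ ^ (j - i) = 1 := by
    intro ξ hξ he hne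
    have hi := hL ξ hξ he i
    have hj' := hL ξ hξ he j
    rw [← e0, ← e1] at hj'
    have hne' : s (i + 1) - ξ * s i ≠ 0 := by
      intro hz
      rw [hz, mul_zero] at hi
      exact hne (sub_eq_zero.mp hi.symm)
    have hpow : ξ ^ i = ξ ^ j := mul_right_cancel₀ hne' (hi.trans hj'.symm)
    rw [← Nat.add_sub_of_le hij.le, pow_add] at hpow
    exact (mul_eq_left₀ (pow_ne_zero i hξ)).mp hpow.symm
  by_cases h1 : s 1 = ζ * s 0
  · by_cases h2 : s 1 = ζ⁻¹ * s 0
    · have hs0 : s 0 ≠ 0 := by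
        rintro hz
        rw [hz, mul_zero] at h1
        exact h0.elim (· hz) (· h1)
      have hself : ζ = ζ⁻¹ := mul_right_cancel₀ hs0 (h1.symm.trans h2)
      refine ⟨2, two_pos, by omega, ?_⟩
      rw [sq]
      nth_rewrite 2 [hself]
      exact mul_inv_cancel₀ hζ
    · refine ⟨j - i, by omega, by omega, ?_⟩
      have := hcol ζ⁻¹ (inv_ne_zero hζ) (by rw [inv_inv, add_comm]) h2
      rwa [inv_pow, inv_eq_one] at this
  · exact ⟨j - i, by omega, by omega, hcol ζ hζ rfl h1⟩

/-- For a triple `(a, b, c)` in a finite set stable under `(a, b, c) ↦ (a, c, 3ac - b)`, the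
element `3a` is `ζ + ζ⁻¹` for a root of unity `ζ` of small order. -/
theorem exists_root_of_unity_of_mem_stable {F k : Type*} [CommRing F] [Field k] [IsAlgClosed k]
    (f : F →+* k) (hf : Function.Injective f) {S : Set (F × F × F)} (hS : S.Finite)
    (hstable : ∀ a b c, (a, b, c) ∈ S → (a, c, 3 * a * c - b) ∈ S) {a b c : F}
    (hmem : (a, b, c) ∈ S) (hbc : b ≠ 0 ∨ c ≠ 0) :
    ∃ (ζ : k) (d : ℕ), 0 < d ∧ d ≤ S.ncard + 1 ∧ ζ ^ d = 1 ∧ f (3 * a) = ζ + ζ⁻¹ := by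
  obtain ⟨ζ, hζ⟩ : ∃ ζ : k, (X ^ 2 - C (f (3 * a)) * X + 1 : k[X]).IsRoot ζ := by
    refine IsAlgClosed.exists_root _ ?_
    have : (X ^ 2 - C (f (3 * a)) * X + 1 : k[X]).degree = 2 := by compute_degree!
    rw [this]
    norm_num
  have hζ' : ζ ^ 2 - f (3 * a) * ζ + 1 = 0 := by simpa [IsRoot] using hζ
  have hζ0 : ζ ≠ 0 := by
    rintro rfl
    simp at hζ'
  have hy : f (3 * a) = ζ + ζ⁻¹ := by
    field_simp
    linear_combination -hζ'
  let T : F × F → F × F := fun v ↦ (v.2, 3 * a * v.2 - v.1)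
  let r : ℕ → F × F := fun m ↦ T^[m] (b, c)
  have hr : ∀ m, r (m + 1) = T (r m) := fun m ↦ Function.iterate_succ_apply' T m (b, c)
  have hrS : ∀ m, (a, (r m).1, (r m).2) ∈ S := by
    intro m
    induction m with
    | zero => exact hmem
    | succ m ih =>
      rw [hr]
      exact hstable _ _ _ ih
  have hfst : ∀ m, (r (m + 1)).1 = (r m).2 := fun m ↦ by rw [hr]
  obtain ⟨i, hi, j, hj, hne, heq⟩ := Finset.exists_ne_map_eq_of_card_lt_of_maps_to
    (s := Finset.range (S.ncard + 1)) (t := hS.toFinset) (f := fun m ↦ (a, (r m).1, (r m).2))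
    (by rw [Finset.card_range, ← Set.ncard_eq_toFinset_card S hS]; exact Nat.lt_succ_self _)
    (fun m _ ↦ by simpa using hrS m)
  wlog hij : i < j generalizing i j
  · exact this j hj i hi hne.symm heq.symm (by omega)
  simp only [Prod.mk.injEq, true_and] at heq
  obtain ⟨d, hd0, hd, hdζ⟩ := exists_pow_eq_one_of_recurrence_collision (s := fun m ↦ f (r m).1)
    (n := S.ncard) hζ0
    (fun m ↦ by
      rw [← hy, hfst (m + 1), hfst m, hr m, ← map_mul, ← map_sub])
    (by
      rw [hfst]
      exact hbc.imp ((map_ne_zero_iff f hf).mpr) ((map_ne_zero_iff f hf).mpr))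
    hij (Nat.lt_succ_iff.mp (Finset.mem_range.mp hj)) (congrArg f heq.1)
    (by rw [hfst, hfst]; exact congrArg f heq.2)
  exact ⟨ζ, d, hd0, hd, hdζ, hy⟩

theorem mem_markoffXstar_iff_of_step {p : ℕ} {a b : ZMod p × ZMod p × ZMod p}
    (h : MarkoffStep p a b) :
    a ∈ MarkoffXstar p ↔ b ∈ MarkoffXstar p := by
  obtain ⟨x, y, z⟩ := a
  simp only [MarkoffXstar, MarkoffX, Set.mem_sdiff, Set.mem_ofPred_eq, Set.mem_singleton_iff]
  rcases h with rfl | rfl | rfl | rfl | rfl | rfl <;>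
    simp only [Prod.mk.injEq] <;>
    refine and_congr ⟨fun h ↦ by linear_combination h, fun h ↦ by linear_combination h⟩
      (not_congr ⟨?_, ?_⟩) <;>
    rintro ⟨h₁, h₂, h₃⟩ <;> simp_all

theorem markoffOrbit_subset_markoffXstar {p : ℕ} {x : ZMod p × ZMod p × ZMod p}
    (hx : x ∈ MarkoffXstar p) : markoffOrbit p x ⊆ MarkoffXstar p := by
  have key : ∀ a b, Relation.EqvGen (MarkoffStep p) a b →
      (a ∈ MarkoffXstar p ↔ b ∈ MarkoffXstar p) := by
    intro a b h
    induction h with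
    | rel _ _ h => exact mem_markoffXstar_iff_of_step h
    | refl => exact Iff.rfl
    | symm _ _ _ ih => exact ih.symm
    | trans _ _ _ _ _ ih₁ ih₂ => exact ih₁.trans ih₂
  exact fun y hy ↦ (key x y hy).mp hx

theorem mem_markoffOrbit_of_step {p : ℕ} {x a b : ZMod p × ZMod p × ZMod p}
    (ha : a ∈ markoffOrbit p x) (h : MarkoffStep p a b) : b ∈ markoffOrbit p x :=
  Relation.EqvGen.trans _ _ _ ha (Relation.EqvGen.rel _ _ h)

/-- A prime `p ≠ 3` is bounded in terms of the size of any orbit in `X*(p)`. -/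
theorem prime_le_of_markoffOrbit {p : ℕ} (hp : p.Prime) (hp3 : 3 < p)
    {x : ZMod p × ZMod p × ZMod p} (hx : x ∈ MarkoffXstar p) :
    p ≤ 20 ^ ((markoffOrbit p x).ncard + 1) ^ 3 := by
  have : Fact p.Prime := ⟨hp⟩
  obtain ⟨a, b, c⟩ := x
  set S := markoffOrbit p (a, b, c)
  have hS : S.Finite := Set.toFinite _
  have hstable : ∀ a b c, (a, b, c) ∈ S → (a, c, 3 * a * c - b) ∈ S := fun u v w h ↦
    mem_markoffOrbit_of_step (mem_markoffOrbit_of_step h (Or.inr (Or.inl rfl)))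
      (Or.inr (Or.inr (Or.inr (Or.inr (Or.inr rfl)))))
  have m₁ : (a, b, c) ∈ S := Relation.EqvGen.refl _
  have m₂ : (b, a, c) ∈ S := mem_markoffOrbit_of_step m₁ (Or.inl rfl)
  have m₃ : (c, b, a) ∈ S := mem_markoffOrbit_of_step m₁ (Or.inr (Or.inr (Or.inl rfl)))
  obtain ⟨heq, hne⟩ := hx
  simp only [MarkoffX, Set.mem_ofPred_eq] at heq
  simp only [Set.mem_singleton_iff, Prod.mk.injEq] at hne
  let k := AlgebraicClosure (ZMod p)
  have : CharP k p := charP_of_injective_algebraMap (algebraMap (ZMod p) k).injective p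
  have h3 : (3 : ZMod p) ≠ 0 := by
    intro h
    have h' : ((3 : ℕ) : ZMod p) = 0 := by exact_mod_cast h
    exact absurd (Nat.le_of_dvd (by norm_num) ((ZMod.natCast_eq_zero_iff 3 p).mp h')) (by omega)
  let f := algebraMap (ZMod p) k
  have hf : Function.Injective f := f.injective
  have n₁ : b ≠ 0 ∨ c ≠ 0 := by
    by_contra! h
    obtain ⟨rfl, rfl⟩ := h
    simp_all
  have n₂ : a ≠ 0 ∨ c ≠ 0 := by
    by_contra! h
    obtain ⟨rfl, rfl⟩ := h
    simp_all
  have n₃ : b ≠ 0 ∨ a ≠ 0 := by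
    by_contra! h
    obtain ⟨rfl, rfl⟩ := h
    simp_all
  obtain ⟨u, d₁, p₁, l₁, hu, eu⟩ := exists_root_of_unity_of_mem_stable f hf hS hstable m₁ n₁
  obtain ⟨v, d₂, p₂, l₂, hv, ev⟩ := exists_root_of_unity_of_mem_stable f hf hS hstable m₂ n₂
  obtain ⟨w, d₃, p₃, l₃, hw, ew⟩ := exists_root_of_unity_of_mem_stable f hf hS hstable m₃ n₃
  have hN : d₁ * d₂ * d₃ ≤ (S.ncard + 1) ^ 3 := by
    calc d₁ * d₂ * d₃ ≤ (S.ncard + 1) * (S.ncard + 1) * (S.ncard + 1) := by gcongr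
      _ = (S.ncard + 1) ^ 3 := by ring
  refine (prime_le_of_markoff_rootsOfUnity (k := k) (N := d₁ * d₂ * d₃) (u := u) (v := v) (w := w)
    (by positivity) ?_ ?_ ?_ ?_ ?_).trans (Nat.pow_le_pow_right (by norm_num) hN)
  · rw [mul_assoc, pow_mul, hu, one_pow]
  · rw [mul_comm d₁, mul_assoc, pow_mul, hv, one_pow]
  · rw [mul_comm, pow_mul, hw, one_pow]
  · rw [← eu, ← ev, ← ew]
    simp only [← map_pow, ← map_mul, ← map_add]
    congr 1
    linear_combination 9 * heq
  · rw [← eu, ← ev, ← ew]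
    simp only [map_eq_zero_iff f hf, mul_eq_zero, h3, false_or]
    exact hne

theorem markoff_orbit_lower_bound :
    ∃ c : ℝ, 0 < c ∧ ∀ p : ℕ, p.Prime → 3 ≤ p →
      ∀ x ∈ MarkoffXstar p,
        c * Real.log p ^ ((1 : ℝ) / 3) ≤ ((markoffOrbit p x ∩ MarkoffXstar p).ncard : ℝ) := by
  refine ⟨1 / 3, by norm_num, fun p hp hp3 x hx ↦ ?_⟩
  have : Fact p.Prime := ⟨hp⟩
  rw [Set.inter_eq_left.mpr (markoffOrbit_subset_markoffXstar hx)]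
  set n := (markoffOrbit p x).ncard
  have hn1 : 1 ≤ n := (Set.ncard_pos (Set.toFinite _)).mpr ⟨x, Relation.EqvGen.refl x⟩
  have hple : p ≤ 20 ^ (n + 1) ^ 3 := by
    rcases hp3.eq_or_lt with rfl | h
    · exact (by norm_num : 3 ≤ 20 ^ 1).trans
        (Nat.pow_le_pow_right (by norm_num) (Nat.one_le_pow _ _ (by omega)))
    · exact prime_le_of_markoffOrbit hp h hx
  have hn1' : (1 : ℝ) ≤ n := by exact_mod_cast hn1
  have hlog20 : Real.log 20 ≤ 3.375 := by
    have h1 : Real.log 20 ≤ Real.log ((2 : ℝ) ^ 4 * 1.25) := by norm_num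
    rw [Real.log_mul (by norm_num) (by norm_num), Real.log_pow] at h1
    have h2 := Real.log_two_lt_d9
    have h3 : Real.log (1.25 : ℝ) ≤ 1.25 - 1 := Real.log_le_sub_one_of_pos (by norm_num)
    norm_num at h1 h2 h3 ⊢
    linarith
  have hlog : Real.log p ≤ (3 * n : ℝ) ^ 3 := by
    calc Real.log p ≤ Real.log ((20 : ℝ) ^ (n + 1) ^ 3) :=
          Real.log_le_log (by exact_mod_cast hp.pos) (by exact_mod_cast hple)
      _ = ((n : ℝ) + 1) ^ 3 * Real.log 20 := by rw [Real.log_pow]; push_cast; rfl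
      _ ≤ (2 * n : ℝ) ^ 3 * 3.375 := by
          gcongr
          linarith
      _ = (3 * n : ℝ) ^ 3 := by ring
  have hroot : Real.log p ^ ((1 : ℝ) / 3) ≤ 3 * n := by
    calc Real.log p ^ ((1 : ℝ) / 3) ≤ ((3 * n : ℝ) ^ 3) ^ ((1 : ℝ) / 3) :=
          Real.rpow_le_rpow (Real.log_natCast_nonneg p) hlog (by norm_num)
      _ = 3 * n := by
          rw [← Real.rpow_natCast, ← Real.rpow_mul (by positivity)]
          norm_num
  linarith
end
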